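/- Suppose either 1 < p < Q and 0 < h ≤ Qp/(Q−p), or p = Q > 1 and h > 0. Let 0 < δ < ∞, let u ∈ N^{1,p}(X) be pointwise defined everywhere by its precise representative, and assume additionally that μ(X) < ∞. Then ∫_X ( ∫_0^δ ( ⨍_{B(x,r)} |u − u(x)|^h dμ )^{p/(h(p−1))} dr/r )^{p−1} dμ(x) < ∞. -/

import Mathlib

open MeasureTheory Metric Filter ENNReal Topology

/-- A nonnegative (extended-real valued) function `g` on `X` is an *upper gradient* of
`u : X → ℝ` if for every rectifiable curve, parametrized by arc length (equivalently, every
`1`-Lipschitz curve) `γ : [0, l] → X`, one has `|u(γ 0) − u(γ l)| ≤ ∫_0^l g(γ t) dt`. -/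
def IsUpperGradient {X : Type*} [MetricSpace X] (u : X → ℝ) (g : X → ℝ≥0∞) : Prop :=
  ∀ (l : ℝ) (γ : ℝ → X), 0 < l → LipschitzOnWith 1 γ (Set.Icc 0 l) →
    ENNReal.ofReal |u (γ 0) - u (γ l)| ≤ ∫⁻ t in Set.Icc (0 : ℝ) l, g (γ t)

/-- `u` belongs to the Newtonian–Sobolev space `N^{1,q}(X)`: `u` is `q`-integrable and has a
`q`-integrable (Borel measurable) upper gradient. -/
def MemN1p {X : Type*} [MetricSpace X] [MeasurableSpace X]
    (μ : Measure X) (q : ℝ) (u : X → ℝ) : Prop :=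
  Measurable u ∧ (∫⁻ x, ENNReal.ofReal |u x| ^ q ∂μ) < ⊤ ∧
    ∃ g : X → ℝ≥0∞, Measurable g ∧ IsUpperGradient u g ∧ (∫⁻ x, g x ^ q ∂μ) < ⊤

set_option linter.unusedSectionVars false
set_option linter.unusedVariables false

/-- Standing assumptions: finite measure, positive on balls, with volume decay of order `Q`. -/
structure Sett {X : Type*} [MetricSpace X] [MeasurableSpace X] (μ : Measure X)
    (K : ℝ≥0∞) (Q : ℝ) : Prop where
  fin : μ Set.univ < ⊤
  pos : ∀ (x : X) (r : ℝ), 0 < r → 0 < μ (ball x r)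
  Kfin : K ≠ ⊤
  Kone : 1 ≤ K
  Qpos : 0 < Q
  vd : ∀ (x y : X) (R r : ℝ), 0 < R → y ∈ ball x R → 0 < r → r ≤ R →
    μ (ball x R) ≤ K * ENNReal.ofReal ((R / r) ^ Q) * μ (ball y r)

/-- The pair `w, f` satisfies the Poincare inequality (with `f` playing the role of `g ^ p`). -/
structure PIpair {X : Type*} [MetricSpace X] [MeasurableSpace X] (μ : Measure X)
    (C σ p : ℝ) (w : X → ℝ) (f : X → ℝ≥0∞) : Prop where
  int : Integrable w μ
  meas : Measurable f
  fint : ∫⁻ x, f x ∂μ < ⊤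
  pi : ∀ (x : X) (r : ℝ), 0 < r →
    ⨍⁻ y in ball x r, ENNReal.ofReal |w y - ⨍ z in ball x r, w z ∂μ| ∂μ ≤
      ENNReal.ofReal (C * r) * (⨍⁻ y in ball x (σ * r), f y ∂μ) ^ (1 / p)

section part1

variable {X : Type*} [MetricSpace X] [MeasurableSpace X] [BorelSpace X] {μ : Measure X}
  {K : ℝ≥0∞} {Q : ℝ}

lemma Sett.ne_top (hS : Sett μ K Q) (s : Set X) : μ s ≠ ⊤ :=
  ((measure_mono (Set.subset_univ s)).trans_lt hS.fin).ne

lemma Sett.secondCountable (hS : Sett μ K Q) : SecondCountableTopology X := by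
  refine Metric.secondCountable_of_almost_dense_set fun ε hε => ?_
  obtain ⟨u, -, hd, hc⟩ := Vitali.exists_disjoint_subfamily_covering_enlargement_closedBall
    (Set.univ : Set X) id (fun _ => ε / 4) (ε / 4) (fun _ _ => le_rfl) 4 (by norm_num)
  refine ⟨u, ?_, fun x => ?_⟩
  · have := Measure.countable_meas_pos_of_disjoint_of_meas_iUnion_ne_top μ
      (As := fun i : u => closedBall (i : X) (ε / 4)) (fun _ => measurableSet_closedBall)
      (fun a b hab => hd a.2 b.2 (fun h => hab (Subtype.ext h))) (hS.ne_top _)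
    have h2 : {i : u | 0 < μ (closedBall (i : X) (ε / 4))} = Set.univ := by
      ext i
      simp only [Set.mem_ofPred_eq, Set.mem_univ, iff_true]
      exact (hS.pos i (ε / 4) (by positivity)).trans_le (measure_mono ball_subset_closedBall)
    rw [h2] at this
    exact Set.countable_coe_iff.1 (Set.countable_univ_iff.1 this)
  · obtain ⟨b, hb, hsub⟩ := hc x trivial
    refine ⟨b, hb, ?_⟩
    have := hsub (mem_closedBall_self (by positivity))
    simpa [mem_closedBall, mul_div_cancel₀] using this

lemma Sett.doubling (hS : Sett μ K Q) : IsUnifLocDoublingMeasure μ := by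
  refine ⟨⟨(K * ENNReal.ofReal (4 ^ Q)).toNNReal, ?_⟩⟩
  filter_upwards [self_mem_nhdsWithin] with ε hε x
  have hε : 0 < ε := hε
  rw [ENNReal.coe_toNNReal (ENNReal.mul_ne_top hS.Kfin ENNReal.ofReal_ne_top)]
  have := hS.vd x x (4 * ε) ε (by positivity) (mem_ball_self (by positivity)) hε (by linarith)
  rw [mul_div_cancel_right₀ _ hε.ne'] at this
  calc μ (closedBall x (2 * ε)) ≤ μ (ball x (4 * ε)) :=
        measure_mono (closedBall_subset_ball (by linarith))
    _ ≤ _ := this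
    _ ≤ _ := by gcongr; exact ball_subset_closedBall

/-- comparison of averages over nested sets -/
lemma lavg_mono {s t : Set X} (hst : s ⊆ t) {c : ℝ≥0∞} (hc : c ≠ ⊤) (ht : μ t ≠ ⊤)
    (hs : μ s ≠ 0) (h : μ t ≤ c * μ s) (f : X → ℝ≥0∞) :
    ⨍⁻ y in s, f y ∂μ ≤ c * ⨍⁻ y in t, f y ∂μ := by
  have hs' : μ s ≠ ⊤ := ((measure_mono hst).trans_lt ht.lt_top).ne
  have ht0 : μ t ≠ 0 := fun h0 => hs (measure_mono_null hst h0)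
  rw [setLAverage_eq, setLAverage_eq, ENNReal.div_le_iff hs hs']
  calc ∫⁻ y in s, f y ∂μ ≤ ∫⁻ y in t, f y ∂μ := lintegral_mono_set hst
    _ = (∫⁻ y in t, f y ∂μ) / μ t * μ t := (ENNReal.div_mul_cancel ht0 ht).symm
    _ ≤ (∫⁻ y in t, f y ∂μ) / μ t * (c * μ s) := by gcongr
    _ = _ := by ring

lemma avg_sub_le {s : Set X} (hs : μ s ≠ 0) (hs' : μ s ≠ ⊤) {w : X → ℝ} (hw : Integrable w μ)
    (a : ℝ) : ENNReal.ofReal |(⨍ y in s, w y ∂μ) - a| ≤ ⨍⁻ y in s, ENNReal.ofReal |w y - a| ∂μ := by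
  have h1 : (⨍ y in s, w y ∂μ) - a = ⨍ y in s, (w y - a) ∂μ := by
    rw [setAverage_eq, setAverage_eq, integral_sub hw.integrableOn (integrableOn_const hs'),
      setIntegral_const, smul_sub, smul_smul, smul_eq_mul, smul_eq_mul,
      measureReal_def, inv_mul_cancel₀, one_mul]
    exact (ENNReal.toReal_pos hs hs').ne'
  rw [h1, setAverage_eq', setLAverage_eq', ← Real.norm_eq_abs, ofReal_norm]
  refine (enorm_integral_le_lintegral_enorm _).trans (le_of_eq ?_)
  refine lintegral_congr fun y => ?_
  rw [← Real.norm_eq_abs, ofReal_norm]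

lemma ball_avg_sub_le (hS : Sett μ K Q) {w : X → ℝ} (hw : Integrable w μ) {x y : X} {R r : ℝ}
    (hR : 0 < R) (hr : 0 < r) (hy : y ∈ ball x R) (hrR : r ≤ R) (hsub : ball y r ⊆ ball x R)
    (a : ℝ) : ENNReal.ofReal |(⨍ z in ball y r, w z ∂μ) - a| ≤
      K * ENNReal.ofReal ((R / r) ^ Q) * ⨍⁻ z in ball x R, ENNReal.ofReal |w z - a| ∂μ :=
  (avg_sub_le (hS.pos y r hr).ne' (hS.ne_top _) hw a).trans
    (lavg_mono hsub (ENNReal.mul_ne_top hS.Kfin ENNReal.ofReal_ne_top) (hS.ne_top _)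
      (hS.pos y r hr).ne' (hS.vd x y R r hR hy hr hrR) _)

lemma lebesgue_ball (hS : Sett μ K Q) {w : X → ℝ} (hw : Integrable w μ) :
    ∀ᵐ y ∂μ, ∀ R : ℝ, 0 < R →
      Tendsto (fun n : ℕ => ⨍ z in ball y ((1 / 2) ^ n * R), w z ∂μ) atTop (𝓝 (w y)) := by
  have := hS.secondCountable
  have := hS.doubling
  have : IsFiniteMeasure μ := ⟨hS.fin⟩
  filter_upwards [IsUnifLocDoublingMeasure.ae_tendsto_average_norm_sub μ
    hw.locallyIntegrable 1] with y hy R hR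
  have hlim : Tendsto (fun n : ℕ => ((1 / 2 : ℝ)) ^ n * R) atTop (𝓝[>] 0) := by
    rw [tendsto_nhdsWithin_iff]
    constructor
    · simpa using (tendsto_pow_atTop_nhds_zero_of_lt_one (r := (1 / 2 : ℝ)) (by norm_num)
        (by norm_num)).mul_const R
    · exact Eventually.of_forall fun n => by simp only [Set.mem_Ioi]; positivity
  have h1 := hy (fun _ : ℕ => y) (fun n : ℕ => (1 / 2 : ℝ) ^ n * R) hlim
    (Eventually.of_forall fun n => mem_closedBall_self (by positivity))
  set c : ℝ≥0∞ := K * ENNReal.ofReal (2 ^ Q) with hc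
  have hcf : c ≠ ⊤ := ENNReal.mul_ne_top hS.Kfin ENNReal.ofReal_ne_top
  have h2 : Tendsto (fun n : ℕ => c * ENNReal.ofReal
      (⨍ z in closedBall y ((1 / 2) ^ n * R), ‖w z - w y‖ ∂μ)) atTop (𝓝 0) := by
    have := ENNReal.Tendsto.const_mul (a := c) (ENNReal.tendsto_ofReal h1) (Or.inr hcf)
    simpa using this
  rw [tendsto_iff_edist_tendsto_0]
  refine tendsto_of_tendsto_of_tendsto_of_le_of_le tendsto_const_nhds h2 (fun _ => zero_le)
    fun n => ?_
  have hrn : 0 < (1 / 2 : ℝ) ^ n * R := by positivity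
  simp only
  rw [edist_dist, Real.dist_eq]
  refine (avg_sub_le (hS.pos y _ hrn).ne' (hS.ne_top _) hw (w y)).trans ?_
  refine (lavg_mono ball_subset_closedBall hcf (hS.ne_top _) (hS.pos y _ hrn).ne' ?_ _).trans ?_
  · have := hS.vd y y (2 * ((1 / 2 : ℝ) ^ n * R)) ((1 / 2 : ℝ) ^ n * R) (by positivity)
      (mem_ball_self (by positivity)) hrn (by linarith)
    rw [mul_div_cancel_right₀ _ hrn.ne'] at this
    exact (measure_mono (closedBall_subset_ball (by linarith))).trans this
  · gcongr
    rw [setAverage_eq', setLAverage_eq', ofReal_integral_eq_lintegral_ofReal]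
    · simp [Real.norm_eq_abs]
    · refine Integrable.smul_measure ?_ ?_
      · exact ((hw.sub (integrable_const _)).norm).integrableOn
      · exact ENNReal.inv_ne_top.2 ((hS.pos y _ hrn).trans_le
          (measure_mono ball_subset_closedBall)).ne'
    · exact Eventually.of_forall fun _ => norm_nonneg _

/-- Telescoping at Lebesgue points. -/
lemma chain (hS : Sett μ K Q) {C σ p : ℝ} {w : X → ℝ} {f : X → ℝ≥0∞}
    (hP : PIpair μ C σ p w f) (hC : 0 < C) :
    ∀ᵐ y ∂μ, ∀ R : ℝ, 0 < R →
      ENNReal.ofReal |w y - ⨍ z in ball y R, w z ∂μ| ≤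
        K * ENNReal.ofReal (2 ^ Q) * ENNReal.ofReal C * ∑' k : ℕ, ENNReal.ofReal ((1 / 2) ^ k * R) *
          (⨍⁻ z in ball y (σ * ((1 / 2) ^ k * R)), f z ∂μ) ^ (1 / p) := by
  filter_upwards [lebesgue_ball hS hP.int] with y hy R hR
  have h := hy R hR
  have := edist_le_tsum_of_edist_le_of_tendsto₀ (f := fun n : ℕ =>
    ⨍ z in ball y ((1 / 2) ^ n * R), w z ∂μ) (fun k : ℕ => K * ENNReal.ofReal (2 ^ Q) *
      ENNReal.ofReal C * (ENNReal.ofReal ((1 / 2) ^ k * R) *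
          (⨍⁻ z in ball y (σ * ((1 / 2) ^ k * R)), f z ∂μ) ^ (1 / p))) ?_ h
  · rw [ENNReal.tsum_mul_left, edist_comm, edist_dist, Real.dist_eq] at this
    simpa using this
  · intro n
    have hrn : 0 < (1 / 2 : ℝ) ^ n * R := by positivity
    have hrn' : 0 < (1 / 2 : ℝ) ^ (n + 1) * R := by positivity
    have hle : (1 / 2 : ℝ) ^ (n + 1) * R ≤ (1 / 2 : ℝ) ^ n * R := by
      rw [pow_succ]; nlinarith
    rw [edist_comm, edist_dist, Real.dist_eq]
    refine (ball_avg_sub_le hS hP.int hrn hrn' (mem_ball_self hrn) hle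
      (ball_subset_ball hle) _).trans ?_
    have e : (1 / 2 : ℝ) ^ n * R / ((1 / 2 : ℝ) ^ (n + 1) * R) = 2 := by
      rw [pow_succ]; field_simp
    rw [e, mul_assoc _ (ENNReal.ofReal C), ← mul_assoc (ENNReal.ofReal C),
      ← ENNReal.ofReal_mul hC.le]
    gcongr
    exact hP.pi y _ hrn

end part1

section part2

lemma num_aux1 {θ ε T : ℝ} (hε : 0 < ε) (hεθ : ε ≤ θ) {k N : ℕ} (hk : k ≤ N)
    (hT : (2 : ℝ) ^ N ≤ T) :
    (1 / 2 : ℝ) ^ k * ((2 : ℝ) ^ k) ^ (θ + 1) ≤ 2 * T ^ θ * ((2 : ℝ) ^ (-ε)) ^ (N - k) := by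
  have hθ : 0 < θ := hε.trans_le hεθ
  have hT0 : 0 < T := lt_of_lt_of_le (by positivity) hT
  have e1 : (1 / 2 : ℝ) ^ k * ((2 : ℝ) ^ k) ^ (θ + 1) = (2 : ℝ) ^ (k * θ) := by
    rw [← Real.rpow_natCast 2 k, ← Real.rpow_mul (by norm_num), one_div, inv_pow,
      ← Real.rpow_natCast 2 k, ← Real.rpow_neg (by norm_num), ← Real.rpow_add (by norm_num)]
    congr 1; ring
  have e2 : ((2 : ℝ) ^ (-ε)) ^ (N - k) = (2 : ℝ) ^ (-ε * ((N : ℝ) - k)) := by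
    rw [← Real.rpow_natCast _ (N - k), ← Real.rpow_mul (by norm_num), Nat.cast_sub hk]
  have e3 : (2 : ℝ) ^ (N * θ) ≤ T ^ θ := by
    rw [Real.rpow_mul (by norm_num), Real.rpow_natCast]
    exact Real.rpow_le_rpow (by positivity) hT hθ.le
  rw [e1, e2]
  have hkN : (k : ℝ) ≤ N := by exact_mod_cast hk
  calc (2 : ℝ) ^ (k * θ) ≤ 2 ^ (N * θ + -ε * ((N : ℝ) - k)) := by
        apply Real.rpow_le_rpow_of_exponent_le (by norm_num)
        nlinarith
    _ = 2 ^ (N * θ) * 2 ^ (-ε * ((N : ℝ) - k)) := Real.rpow_add (by norm_num) _ _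
    _ ≤ T ^ θ * 2 ^ (-ε * ((N : ℝ) - k)) := by gcongr
    _ ≤ _ := by
        have : 0 ≤ T ^ θ * (2 : ℝ) ^ (-ε * ((N : ℝ) - k)) := by positivity
        linarith

lemma num_aux2 {ε T : ℝ} (hε1 : ε ≤ 1) {k N : ℕ} (hk : N ≤ k)
    (hT : T < (2 : ℝ) ^ (N + 1)) :
    (1 / 2 : ℝ) ^ k * T ≤ 2 * ((2 : ℝ) ^ (-ε)) ^ (k - N) := by
  have h1 : (1 / 2 : ℝ) ≤ 2 ^ (-ε) := by
    rw [one_div, ← Real.rpow_neg_one]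
    exact Real.rpow_le_rpow_of_exponent_le (by norm_num) (by linarith)
  calc (1 / 2 : ℝ) ^ k * T ≤ (1 / 2 : ℝ) ^ k * 2 ^ (N + 1) := by gcongr
    _ = 2 * (1 / 2 : ℝ) ^ (k - N) := by
        obtain ⟨m, rfl⟩ := Nat.exists_eq_add_of_le hk
        rw [Nat.add_sub_cancel_left, pow_add, pow_succ]
        field_simp
        rw [← mul_pow]; norm_num
    _ ≤ _ := by gcongr

lemma summable_natAbs {c : ℝ} (h0 : 0 ≤ c) (h1 : c < 1) :
    Summable (fun z : ℤ => c ^ z.natAbs) := by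
  apply Summable.of_nat_of_neg
  · simpa using summable_geometric_of_lt_one h0 h1
  · simpa using summable_geometric_of_lt_one h0 h1

lemma numeric {p Q : ℝ} (hp : 0 < p) (hpQ : p < Q) :
    ∃ C2 : ℝ≥0∞, C2 ≠ ⊤ ∧ ∀ (D : ℝ≥0∞), 1 ≤ D → ∀ (A s : ℝ), 0 < A → A ≤ s →
      ∀ b : ℕ → ℝ≥0∞, (∀ k, b k ≤ ENNReal.ofReal s) →
      (∀ k, b k ≤ D * ENNReal.ofReal (((2 : ℝ) ^ k) ^ Q * A)) →
      ∑' k, ENNReal.ofReal ((1 / 2) ^ k) * b k ^ (1 / p) ≤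
        C2 * D ^ (1 / p) * ENNReal.ofReal (A ^ (1 / Q) * s ^ (1 / p - 1 / Q)) := by
  have hQ : 0 < Q := hp.trans hpQ
  set θ : ℝ := Q / p - 1 with hθ
  have hθ0 : 0 < θ := by rw [hθ, sub_pos, one_lt_div hp]; exact hpQ
  set ε : ℝ := min 1 θ with hε
  have hε0 : 0 < ε := lt_min one_pos hθ0
  set c : ℝ := (2 : ℝ) ^ (-ε) with hc
  have hc0 : 0 ≤ c := by positivity
  have hc1 : c < 1 := Real.rpow_lt_one_of_one_lt_of_neg (by norm_num) (by linarith)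
  have hsum := summable_natAbs hc0 hc1
  refine ⟨2 * ∑' z : ℤ, ENNReal.ofReal (c ^ z.natAbs), ?_, ?_⟩
  · rw [← ENNReal.ofReal_tsum_of_nonneg (fun _ => by positivity) hsum]
    exact ENNReal.mul_ne_top (by norm_num) ENNReal.ofReal_ne_top
  intro D hD A s hA hAs b hb1 hb2
  have hs : 0 < s := hA.trans_le hAs
  set T : ℝ := (s / A) ^ (1 / Q) with hT
  have hT1 : 1 ≤ T := Real.one_le_rpow ((one_le_div hA).2 hAs) (by positivity)
  have hT0 : 0 < T := by linarith
  obtain ⟨N, hN1, hN2⟩ := exists_nat_pow_near hT1 (one_lt_two)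
  have hsT : s = A * T ^ Q := by
    rw [hT, ← Real.rpow_mul (by positivity), one_div_mul_cancel hQ.ne', Real.rpow_one]
    field_simp
  have hQp : Q * (1 / p) = θ + 1 := by rw [hθ]; ring
  have hM : A ^ (1 / Q) * s ^ (1 / p - 1 / Q) = A ^ (1 / p) * T ^ θ := by
    rw [hsT, Real.mul_rpow hA.le (by positivity), ← mul_assoc, ← Real.rpow_add hA,
      ← Real.rpow_mul hT0.le]
    congr 2
    · ring
    · rw [hθ]; field_simp
  have hterm : ∀ k, ENNReal.ofReal ((1 / 2) ^ k) * b k ^ (1 / p) ≤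
      2 * D ^ (1 / p) * ENNReal.ofReal (A ^ (1 / Q) * s ^ (1 / p - 1 / Q)) *
        ENNReal.ofReal (c ^ ((k : ℤ) - N).natAbs) := by
    intro k
    have key : ∃ Y : ℝ, 0 ≤ Y ∧ b k ≤ D * ENNReal.ofReal Y ∧
        (1 / 2 : ℝ) ^ k * Y ^ (1 / p) ≤ 2 * (A ^ (1 / p) * T ^ θ) * c ^ ((k : ℤ) - N).natAbs := by
      rcases le_total k N with hk | hk
      · refine ⟨_, by positivity, hb2 k, ?_⟩
        have : ((k : ℤ) - N).natAbs = N - k := by omega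
        rw [this, Real.mul_rpow (by positivity) hA.le, ← Real.rpow_mul (by positivity), hQp]
        have := num_aux1 hε0 (min_le_right 1 θ) hk hN1
        have h2 := mul_le_mul_of_nonneg_left this (Real.rpow_nonneg hA.le (1 / p))
        calc _ = A ^ (1 / p) * ((1 / 2 : ℝ) ^ k * ((2 : ℝ) ^ k) ^ (θ + 1)) := by ring
          _ ≤ _ := h2
          _ = _ := by ring
      · refine ⟨s, hs.le, (hb1 k).trans (le_mul_of_one_le_left zero_le hD), ?_⟩
        have : ((k : ℤ) - N).natAbs = k - N := by omega
        rw [this, hsT, Real.mul_rpow hA.le (by positivity), ← Real.rpow_mul hT0.le, hQp,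
          Real.rpow_add hT0, Real.rpow_one]
        have := num_aux2 (min_le_left 1 θ) hk hN2
        have h2 := mul_le_mul_of_nonneg_left this
          (show 0 ≤ A ^ (1 / p) * T ^ θ by positivity)
        calc _ = A ^ (1 / p) * T ^ θ * ((1 / 2 : ℝ) ^ k * T) := by ring
          _ ≤ _ := h2
          _ = _ := by ring
    obtain ⟨Y, hY0, hbY, hY⟩ := key
    calc ENNReal.ofReal ((1 / 2) ^ k) * b k ^ (1 / p)
        ≤ ENNReal.ofReal ((1 / 2) ^ k) * (D * ENNReal.ofReal Y) ^ (1 / p) := by gcongr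
      _ = D ^ (1 / p) * ENNReal.ofReal ((1 / 2) ^ k * Y ^ (1 / p)) := by
          rw [ENNReal.mul_rpow_of_nonneg _ _ (by positivity),
            ENNReal.ofReal_rpow_of_nonneg hY0 (by positivity),
            ENNReal.ofReal_mul (by positivity)]
          ring
      _ ≤ D ^ (1 / p) * ENNReal.ofReal (2 * (A ^ (1 / p) * T ^ θ) * c ^ ((k : ℤ) - N).natAbs) := by
          gcongr
      _ = _ := by
          rw [hM, ENNReal.ofReal_mul (by positivity), ENNReal.ofReal_mul (by positivity)]
          simp only [ENNReal.ofReal_ofNat]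
          ring
  calc _ ≤ ∑' k : ℕ, 2 * D ^ (1 / p) * ENNReal.ofReal (A ^ (1 / Q) * s ^ (1 / p - 1 / Q)) *
        ENNReal.ofReal (c ^ ((k : ℤ) - N).natAbs) := ENNReal.tsum_le_tsum hterm
    _ = 2 * D ^ (1 / p) * ENNReal.ofReal (A ^ (1 / Q) * s ^ (1 / p - 1 / Q)) *
        ∑' k : ℕ, ENNReal.ofReal (c ^ ((k : ℤ) - N).natAbs) := ENNReal.tsum_mul_left
    _ ≤ 2 * D ^ (1 / p) * ENNReal.ofReal (A ^ (1 / Q) * s ^ (1 / p - 1 / Q)) *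
        ∑' z : ℤ, ENNReal.ofReal (c ^ z.natAbs) := by
        gcongr
        exact ENNReal.tsum_comp_le_tsum_of_injective (f := fun k : ℕ => (k : ℤ) - N)
          (fun a b h => by simpa using h) (fun z : ℤ => ENNReal.ofReal (c ^ z.natAbs))
    _ = _ := by ring

variable {X : Type*} [MetricSpace X] [MeasurableSpace X] [BorelSpace X] {μ : Measure X}
  {K : ℝ≥0∞} {Q : ℝ}

lemma vitali_weak (hS : Sett μ K Q) (f : X → ℝ≥0∞) (E U : Set X) (ρ : ℝ) (s : ℝ≥0∞)
    (hE : ∀ y ∈ E, ∃ r, 0 < r ∧ r ≤ ρ ∧ ball y r ⊆ U ∧ s * μ (ball y r) ≤ ∫⁻ z in ball y r, f z ∂μ) :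
    s * μ E ≤ K * ENNReal.ofReal (5 ^ Q) * ∫⁻ z in U, f z ∂μ := by
  have := hS.secondCountable
  choose! r hr0 hrρ hrU hrf using hE
  obtain ⟨u, huE, hd, hc⟩ := Vitali.exists_disjoint_subfamily_covering_enlargement_closedBall
    E id r ρ hrρ 4 (by norm_num)
  have hd' : u.PairwiseDisjoint fun a => ball a (r a) := fun a ha b hb hab =>
    (hd ha hb hab).mono ball_subset_closedBall ball_subset_closedBall
  have hcount : u.Countable := hd'.countable_of_isOpen (fun _ _ => isOpen_ball)
    (fun a ha => nonempty_ball.2 (hr0 a (huE ha)))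
  have hcov : E ⊆ ⋃ b ∈ u, ball b (5 * r b) := by
    intro y hy
    obtain ⟨b, hb, hsub⟩ := hc y hy
    have h1 := hsub (mem_closedBall_self (hr0 y hy).le)
    have h0 := hr0 b (huE hb)
    refine Set.mem_iUnion₂.2 ⟨b, hb, ?_⟩
    simp only [id, mem_closedBall, mem_ball] at h1 ⊢
    linarith
  calc s * μ E ≤ s * ∑' b : u, μ (ball (b : X) (5 * r b)) := by
        gcongr
        exact (measure_mono hcov).trans (measure_biUnion_le μ hcount _)
    _ ≤ s * ∑' b : u, K * ENNReal.ofReal (5 ^ Q) * μ (ball (b : X) (r b)) := by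
        gcongr with b
        have h0 := hr0 b (huE b.2)
        have := hS.vd b b (5 * r b) (r b) (by positivity) (mem_ball_self (by positivity)) h0
          (by linarith)
        rwa [mul_div_cancel_right₀ _ h0.ne'] at this
    _ = K * ENNReal.ofReal (5 ^ Q) * ∑' b : u, s * μ (ball (b : X) (r b)) := by
        rw [ENNReal.tsum_mul_left, ENNReal.tsum_mul_left]; ring
    _ ≤ K * ENNReal.ofReal (5 ^ Q) * ∑' b : u, ∫⁻ z in ball (b : X) (r b), f z ∂μ := by
        gcongr with b
        exact hrf b (huE b.2)
    _ = K * ENNReal.ofReal (5 ^ Q) * ∫⁻ z in ⋃ b ∈ u, ball b (r b), f z ∂μ := by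
        rw [lintegral_biUnion hcount (fun _ _ => measurableSet_ball) hd']
    _ ≤ _ := by
        gcongr
        exact Set.iUnion₂_subset fun b hb => hrU b (huE hb)

lemma PIpair.avg_fin (hS : Sett μ K Q) {C σ p : ℝ} {w : X → ℝ} {f : X → ℝ≥0∞}
    (hP : PIpair μ C σ p w f) (x : X) {r : ℝ} (hr : 0 < r) :
    ⨍⁻ y in ball x r, f y ∂μ ≠ ⊤ := by
  rw [setLAverage_eq]
  exact ENNReal.div_ne_top ((setLIntegral_le_lintegral _ _).trans_lt hP.fint).ne (hS.pos x r hr).ne'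

/-- pointwise bound for the oscillation over a ball -/
lemma osc_bound (hS : Sett μ K Q) {C σ p : ℝ} {w : X → ℝ} {f : X → ℝ≥0∞}
    (hP : PIpair μ C σ p w f) (hC : 0 < C) (hσ : 1 ≤ σ) (hp : 0 < p) :
    ∀ᵐ y ∂μ, ∀ (x : X) (R : ℝ), 0 < R → y ∈ ball x R →
      ENNReal.ofReal |w y - ⨍ z in ball x R, w z ∂μ| ≤
        K * ENNReal.ofReal (2 ^ Q) * ENNReal.ofReal C * ENNReal.ofReal R *
        (∑' k : ℕ, ENNReal.ofReal ((1 / 2) ^ k) *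
          (⨍⁻ z in ball y (σ * ((1 / 2) ^ k * R)), f z ∂μ) ^ (1 / p) +
          4 * (⨍⁻ z in ball x (2 * σ * R), f z ∂μ) ^ (1 / p)) := by
  filter_upwards [chain hS hP hC] with y hy x R hR hyx
  have h1 := hy R hR
  have h2R : 0 < 2 * R := by positivity
  have e2 : 2 * R / R = 2 := by field_simp
  have hpi := hP.pi x (2 * R) h2R
  have e3 : σ * (2 * R) = 2 * σ * R := by ring
  rw [e3] at hpi
  set a := ⨍ z in ball x (2 * R), w z ∂μ with ha
  have h2 := ball_avg_sub_le hS hP.int h2R hR (x := x) (y := y)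
    (ball_subset_ball (by linarith) hyx) (by linarith)
    (ball_subset_ball' (by rw [mem_ball] at hyx; linarith)) a
  have h3 := ball_avg_sub_le hS hP.int h2R hR (x := x) (y := x)
    (mem_ball_self h2R) (by linarith) (ball_subset_ball (by linarith)) a
  rw [e2] at h2 h3
  have h4 := h2.trans (mul_le_mul_right hpi _)
  have h5 := h3.trans (mul_le_mul_right hpi _)
  have tri : ENNReal.ofReal |w y - ⨍ z in ball x R, w z ∂μ| ≤
      ENNReal.ofReal |w y - ⨍ z in ball y R, w z ∂μ| +
      ENNReal.ofReal |(⨍ z in ball y R, w z ∂μ) - a| +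
      ENNReal.ofReal |(⨍ z in ball x R, w z ∂μ) - a| := by
    rw [← ENNReal.ofReal_add (by positivity) (by positivity),
      ← ENNReal.ofReal_add (by positivity) (by positivity)]
    apply ENNReal.ofReal_le_ofReal
    rw [abs_sub_comm (⨍ z in ball x R, w z ∂μ) a]
    exact (abs_sub_le _ a _).trans (by gcongr; exact abs_sub_le _ _ _)
  refine tri.trans ((add_le_add (add_le_add h1 h4) h5).trans (le_of_eq ?_))
  have e4 : ENNReal.ofReal (C * (2 * R)) = 2 * ENNReal.ofReal C * ENNReal.ofReal R := by
    rw [ENNReal.ofReal_mul hC.le, ENNReal.ofReal_mul (by norm_num)]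
    simp only [ENNReal.ofReal_ofNat]; ring
  have e5 : ∀ k : ℕ, ENNReal.ofReal ((1 / 2) ^ k * R) *
          (⨍⁻ z in ball y (σ * ((1 / 2) ^ k * R)), f z ∂μ) ^ (1 / p) =
        ENNReal.ofReal R * (ENNReal.ofReal ((1 / 2) ^ k) *
          (⨍⁻ z in ball y (σ * ((1 / 2) ^ k * R)), f z ∂μ) ^ (1 / p)) := fun k => by
    rw [ENNReal.ofReal_mul (by positivity)]; ring
  rw [tsum_congr e5, ENNReal.tsum_mul_left, e4]
  ring

lemma avg_small (hS : Sett μ K Q) {σ : ℝ} (hσ : 1 ≤ σ) (f : X → ℝ≥0∞) {x y : X} {R : ℝ}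
    (hR : 0 < R) (hy : y ∈ ball x R) (k : ℕ) :
    ball y (σ * ((1 / 2) ^ k * R)) ⊆ ball x (2 * σ * R) ∧
    ⨍⁻ z in ball y (σ * ((1 / 2) ^ k * R)), f z ∂μ ≤
      K * ENNReal.ofReal (2 ^ Q) * ENNReal.ofReal (((2 : ℝ) ^ k) ^ Q) *
        ⨍⁻ z in ball x (2 * σ * R), f z ∂μ := by
  have hσ0 : 0 < σ := by linarith
  have hk : (1 / 2 : ℝ) ^ k ≤ 1 := pow_le_one₀ (by norm_num) (by norm_num)
  have h1 : σ * ((1 / 2) ^ k * R) ≤ σ * R := by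
    gcongr; exact mul_le_of_le_one_left hR.le hk
  have hr : 0 < σ * ((1 / 2 : ℝ) ^ k * R) := by positivity
  have hRσ : R ≤ σ * R := le_mul_of_one_le_left hR.le hσ
  have hsub : ball y (σ * ((1 / 2) ^ k * R)) ⊆ ball x (2 * σ * R) := by
    apply ball_subset_ball'
    rw [mem_ball] at hy
    linarith
  refine ⟨hsub, ?_⟩
  have hvd := hS.vd x y (2 * σ * R) (σ * ((1 / 2) ^ k * R)) (by positivity)
    (ball_subset_ball (by linarith) hy) hr (by linarith)
  have e : 2 * σ * R / (σ * ((1 / 2) ^ k * R)) = 2 * 2 ^ k := by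
    field_simp
    rw [← mul_pow]; norm_num
  rw [e, Real.mul_rpow (by norm_num) (by positivity), ENNReal.ofReal_mul (by positivity),
    ← mul_assoc] at hvd
  exact lavg_mono hsub (by
    exact ENNReal.mul_ne_top (ENNReal.mul_ne_top hS.Kfin ENNReal.ofReal_ne_top)
      ENNReal.ofReal_ne_top) (hS.ne_top _) (hS.pos _ _ hr).ne' hvd f

end part2

section part3

variable {X : Type*} [MetricSpace X] [MeasurableSpace X] [BorelSpace X] {μ : Measure X}
  {K : ℝ≥0∞} {Q : ℝ}

/-- weak type Sobolev-Poincare inequality -/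
lemma weak_type (hS : Sett μ K Q) {C σ p q : ℝ} (hC : 0 < C) (hσ : 1 ≤ σ) (hp : 0 < p)
    (hpQ : p < Q) (hq : 0 < q) (hpq : 1 / q = 1 / p - 1 / Q) :
    ∃ C4 : ℝ≥0∞, C4 ≠ ⊤ ∧ ∀ (w : X → ℝ) (f : X → ℝ≥0∞), PIpair μ C σ p w f →
      ∀ (x : X) (R : ℝ), 0 < R → ∀ t : ℝ, 0 < t →
      ENNReal.ofReal t ^ q * μ {y ∈ ball x R | t < |w y - ⨍ z in ball x R, w z ∂μ|} ≤
        C4 * ENNReal.ofReal R ^ q * (⨍⁻ z in ball x (2 * σ * R), f z ∂μ) ^ (q / p) *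
          μ (ball x R) := by
  have hQ : 0 < Q := hp.trans hpQ
  have hσ0 : 0 < σ := by linarith
  obtain ⟨C2, hC2, hnum⟩ := numeric hp hpQ
  set D : ℝ≥0∞ := K * ENNReal.ofReal (2 ^ Q) with hD
  have hDf : D ≠ ⊤ := ENNReal.mul_ne_top hS.Kfin ENNReal.ofReal_ne_top
  have hD1 : 1 ≤ D := by
    rw [hD, ← one_mul (1 : ℝ≥0∞)]
    gcongr
    · exact hS.Kone
    · rw [← ENNReal.ofReal_one]
      exact ENNReal.ofReal_le_ofReal (Real.one_le_rpow (by norm_num) hQ.le)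
  set E3 : ℝ≥0∞ := D * ENNReal.ofReal C * (C2 * D ^ (1 / p) + 4) with hE3
  have hE3f : E3 ≠ ⊤ := ENNReal.mul_ne_top (ENNReal.mul_ne_top hDf ENNReal.ofReal_ne_top)
    (ENNReal.add_ne_top.2 ⟨ENNReal.mul_ne_top hC2 (ENNReal.rpow_ne_top_of_nonneg (by positivity) hDf),
      by norm_num⟩)
  have hE30 : E3 ≠ 0 := by
    rw [hE3]
    refine mul_ne_zero (mul_ne_zero (one_pos.trans_le hD1).ne' (by simpa using hC)) (by simp)
  set C3 : ℝ := E3.toReal with hC3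
  have hC30 : 0 < C3 := ENNReal.toReal_pos hE30 hE3f
  have hE3C : E3 = ENNReal.ofReal C3 := (ENNReal.ofReal_toReal hE3f).symm
  set C5 : ℝ≥0∞ := K * ENNReal.ofReal (5 ^ Q) * (K * ENNReal.ofReal ((2 * σ) ^ Q)) with hC5
  have hC5f : C5 ≠ ⊤ := ENNReal.mul_ne_top (ENNReal.mul_ne_top hS.Kfin ENNReal.ofReal_ne_top)
    (ENNReal.mul_ne_top hS.Kfin ENNReal.ofReal_ne_top)
  refine ⟨ENNReal.ofReal (C3 ^ q) * (1 + C5), ENNReal.mul_ne_top ENNReal.ofReal_ne_top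
    (ENNReal.add_ne_top.2 ⟨by norm_num, hC5f⟩), ?_⟩
  intro w f hP x R hR t ht
  have hosc := osc_bound hS hP hC hσ hp
  set Ae := ⨍⁻ z in ball x (2 * σ * R), f z ∂μ with hAe
  have hAf : Ae ≠ ⊤ := hP.avg_fin hS x (by positivity)
  by_cases hA0 : Ae = 0
  · -- degenerate case
    have hnull : μ {y ∈ ball x R | t < |w y - ⨍ z in ball x R, w z ∂μ|} = 0 := by
      rw [← nonpos_iff_eq_zero, ← measure_empty (μ := μ)]
      refine measure_mono_ae ?_
      filter_upwards [hosc] with y hy hyE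
      obtain ⟨hyx, hyt⟩ := hyE
      have h1 := hy x R hR hyx
      rw [← hAe, hA0] at h1
      have h2 : ∀ k : ℕ, ⨍⁻ z in ball y (σ * ((1 / 2) ^ k * R)), f z ∂μ = 0 := fun k => by
        have := (avg_small hS hσ f hR hyx k).2
        rw [← hAe, hA0, mul_zero] at this
        exact le_antisymm this zero_le
      simp only [h2] at h1
      rw [ENNReal.zero_rpow_of_pos (by positivity)] at h1
      simp only [mul_zero, tsum_zero, add_zero] at h1
      have h3 := (ENNReal.ofReal_eq_zero.1 (le_antisymm h1 zero_le))
      exact absurd hyt (by linarith)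
    rw [hnull, mul_zero]
    exact zero_le
  set A : ℝ := Ae.toReal with hA
  have hApos : 0 < A := ENNReal.toReal_pos hA0 hAf
  have hAeA : Ae = ENNReal.ofReal A := (ENNReal.ofReal_toReal hAf).symm
  set s : ℝ := (t / (C3 * R * A ^ (1 / Q))) ^ q with hs
  have hs0 : 0 < s := by positivity
  have hst : C3 * R * (A ^ (1 / Q) * s ^ (1 / q)) = t := by
    rw [hs, ← Real.rpow_mul (by positivity), mul_one_div_cancel hq.ne', Real.rpow_one]
    field_simp
  have htq : ENNReal.ofReal t ^ q =
      ENNReal.ofReal (C3 ^ q) * ENNReal.ofReal R ^ q * (Ae ^ (q / Q) * ENNReal.ofReal s) := by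
    rw [hAeA, ENNReal.ofReal_rpow_of_nonneg ht.le hq.le, ENNReal.ofReal_rpow_of_nonneg hR.le hq.le,
      ENNReal.ofReal_rpow_of_nonneg hApos.le (by positivity), ← ENNReal.ofReal_mul (by positivity),
      ← ENNReal.ofReal_mul (by positivity), ← ENNReal.ofReal_mul (by positivity), ← hst,
      Real.mul_rpow (by positivity) (by positivity), Real.mul_rpow (by positivity) (by positivity),
      Real.mul_rpow (by positivity) (by positivity), ← Real.rpow_mul hApos.le,
      ← Real.rpow_mul hs0.le, one_div_mul_cancel hq.ne', Real.rpow_one]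
    congr 4
    ring
  have hexp : q / Q + 1 = q / p := by
    have h1 : 1 / p = 1 / q + 1 / Q := by linarith
    have : q * (1 / p) = q * (1 / q + 1 / Q) := by rw [h1]
    rw [mul_add, mul_one_div_cancel hq.ne'] at this
    rw [div_eq_mul_one_div q p, this]; ring
  have hAexp : Ae ^ (q / Q) * Ae = Ae ^ (q / p) := by
    rw [← hexp, ENNReal.rpow_add _ _ hA0 hAf, ENNReal.rpow_one]
  rcases lt_or_ge s A with hsA | hsA
  · calc ENNReal.ofReal t ^ q * μ {y ∈ ball x R | t < |w y - ⨍ z in ball x R, w z ∂μ|}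
        ≤ ENNReal.ofReal (C3 ^ q) * ENNReal.ofReal R ^ q * (Ae ^ (q / Q) * Ae) * μ (ball x R) := by
          rw [htq]
          gcongr
          · rw [hAeA]; exact ENNReal.ofReal_le_ofReal hsA.le
          · exact fun y hy => hy.1
      _ = ENNReal.ofReal (C3 ^ q) * 1 * ENNReal.ofReal R ^ q * Ae ^ (q / p) * μ (ball x R) := by
          rw [hAexp, mul_one]
      _ ≤ _ := by gcongr; exact le_self_add
  · -- main case
    set E' : Set X := {y ∈ ball x R | ∃ k : ℕ, ENNReal.ofReal s <
      ⨍⁻ z in ball y (σ * ((1 / 2) ^ k * R)), f z ∂μ} with hE'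
    have hEE : μ {y ∈ ball x R | t < |w y - ⨍ z in ball x R, w z ∂μ|} ≤ μ E' := by
      refine measure_mono_ae ?_
      filter_upwards [hosc] with y hy hyE
      obtain ⟨hyx, hyt⟩ := hyE
      refine ⟨hyx, ?_⟩
      by_contra! hcon
      have h1 := hy x R hR hyx
      have h2 := hnum D hD1 A s hApos hsA _ hcon (fun k => by
        refine (avg_small hS hσ f hR hyx k).2.trans (le_of_eq ?_)
        rw [← hAe, hAeA, ENNReal.ofReal_mul (by positivity), mul_assoc])
      rw [← hpq] at h2
      have h3 : Ae ^ (1 / p) ≤ ENNReal.ofReal (A ^ (1 / Q) * s ^ (1 / q)) := by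
        rw [hAeA, ENNReal.ofReal_rpow_of_nonneg hApos.le (by positivity)]
        apply ENNReal.ofReal_le_ofReal
        have : 1 / p = 1 / Q + 1 / q := by linarith
        rw [this, Real.rpow_add hApos]
        gcongr
      have h4 : ENNReal.ofReal |w y - ⨍ z in ball x R, w z ∂μ| ≤ ENNReal.ofReal t := by
        refine h1.trans ?_
        calc _ ≤ D * ENNReal.ofReal C * ENNReal.ofReal R *
              (C2 * D ^ (1 / p) * ENNReal.ofReal (A ^ (1 / Q) * s ^ (1 / q)) +
                4 * ENNReal.ofReal (A ^ (1 / Q) * s ^ (1 / q))) := by gcongr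
          _ = E3 * ENNReal.ofReal R * ENNReal.ofReal (A ^ (1 / Q) * s ^ (1 / q)) := by
              rw [hE3]; ring
          _ = _ := by
              rw [hE3C, ← ENNReal.ofReal_mul (by positivity), ← ENNReal.ofReal_mul (by positivity),
                hst]
      have := (ENNReal.ofReal_le_ofReal_iff ht.le).1 h4
      linarith
    have hvit := vitali_weak hS f E' (ball x (2 * σ * R)) (σ * R) (ENNReal.ofReal s) (by
      rintro y ⟨hyx, k, hk⟩
      have hr : 0 < σ * ((1 / 2 : ℝ) ^ k * R) := by positivity
      refine ⟨σ * ((1 / 2) ^ k * R), hr, ?_, (avg_small hS hσ f hR hyx k).1, ?_⟩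
      · gcongr
        exact mul_le_of_le_one_left hR.le (pow_le_one₀ (by norm_num) (by norm_num))
      · rw [setLAverage_eq] at hk
        exact (ENNReal.le_div_iff_mul_le (Or.inl (hS.pos y _ hr).ne')
          (Or.inl (hS.ne_top _))).1 hk.le)
    have hint : ∫⁻ z in ball x (2 * σ * R), f z ∂μ = Ae * μ (ball x (2 * σ * R)) := by
      rw [hAe, setLAverage_eq, ENNReal.div_mul_cancel (hS.pos x _ (by positivity)).ne'
        (hS.ne_top _)]
    have hRσ : R ≤ σ * R := le_mul_of_one_le_left hR.le hσ
    have hvd := hS.vd x x (2 * σ * R) R (by positivity) (mem_ball_self (by positivity)) hR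
      (by nlinarith)
    rw [mul_div_cancel_right₀ _ hR.ne'] at hvd
    calc ENNReal.ofReal t ^ q * μ {y ∈ ball x R | t < |w y - ⨍ z in ball x R, w z ∂μ|}
        ≤ ENNReal.ofReal (C3 ^ q) * ENNReal.ofReal R ^ q * Ae ^ (q / Q) *
          (ENNReal.ofReal s * μ E') := by
          rw [htq]
          calc _ ≤ ENNReal.ofReal (C3 ^ q) * ENNReal.ofReal R ^ q *
              (Ae ^ (q / Q) * ENNReal.ofReal s) * μ E' := by gcongr
            _ = _ := by ring
      _ ≤ ENNReal.ofReal (C3 ^ q) * ENNReal.ofReal R ^ q * Ae ^ (q / Q) *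
          (K * ENNReal.ofReal (5 ^ Q) * (Ae * (K * ENNReal.ofReal ((2 * σ) ^ Q) *
            μ (ball x R)))) := by
          refine mul_le_mul_right (hvit.trans ?_) _
          rw [hint]
          gcongr
      _ = ENNReal.ofReal (C3 ^ q) * C5 * ENNReal.ofReal R ^ q * (Ae ^ (q / Q) * Ae) *
            μ (ball x R) := by
          rw [hC5]; ring
      _ ≤ _ := by
          rw [hAexp]
          gcongr
          exact le_add_self

/-- weak type estimate for nonnegative functions vanishing on half of the ball -/
lemma weak_half (hS : Sett μ K Q) {C σ p q : ℝ} (hC : 0 < C) (hσ : 1 ≤ σ) (hp : 0 < p)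
    (hpQ : p < Q) (hq : 0 < q) (hpq : 1 / q = 1 / p - 1 / Q) :
    ∃ C4 : ℝ≥0∞, C4 ≠ ⊤ ∧ ∀ (w : X → ℝ) (f : X → ℝ≥0∞), PIpair μ C σ p w f →
      (∀ y, 0 ≤ w y) → ∀ (x : X) (R : ℝ), 0 < R →
      μ (ball x R) ≤ 2 * μ {y ∈ ball x R | w y = 0} → ∀ t : ℝ, 0 < t →
      ENNReal.ofReal t ^ q * μ {y ∈ ball x R | t ≤ w y} ≤
        C4 * ENNReal.ofReal R ^ q * (⨍⁻ z in ball x (2 * σ * R), f z ∂μ) ^ (q / p) *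
          μ (ball x R) := by
  obtain ⟨C4, hC4, h⟩ := weak_type hS hC hσ hp hpQ hq hpq
  refine ⟨2 * ENNReal.ofReal (3 ^ q) * C4, ENNReal.mul_ne_top
    (ENNReal.mul_ne_top (by norm_num) ENNReal.ofReal_ne_top) hC4, ?_⟩
  intro w f hP hw x R hR hhalf t ht
  have h1 := h w f hP x R hR (t / 3) (by positivity)
  have h2 : μ {y ∈ ball x R | t ≤ w y} ≤
      2 * μ {y ∈ ball x R | t / 3 < |w y - ⨍ z in ball x R, w z ∂μ|} := by
    rcases le_or_gt (⨍ z in ball x R, w z ∂μ) (t / 2) with hc | hc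
    · refine le_trans (measure_mono ?_) (le_mul_of_one_le_left zero_le (by norm_num))
      rintro y ⟨hy, hyt⟩
      refine ⟨hy, lt_of_lt_of_le ?_ (le_abs_self _)⟩
      linarith
    · refine ((measure_mono fun y hy => hy.1).trans hhalf).trans ?_
      gcongr 2 * μ ?_
      rintro y ⟨hy, hy0⟩
      refine ⟨hy, lt_of_lt_of_le ?_ (neg_le_abs _)⟩
      rw [hy0]; linarith
  have e : ENNReal.ofReal t ^ q = ENNReal.ofReal (3 ^ q) * ENNReal.ofReal (t / 3) ^ q := by
    rw [ENNReal.ofReal_rpow_of_nonneg ht.le hq.le,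
      ENNReal.ofReal_rpow_of_nonneg (by positivity) hq.le, ← ENNReal.ofReal_mul (by positivity),
      ← Real.mul_rpow (by positivity) (by positivity), mul_div_cancel₀ _ (by norm_num)]
  calc _ ≤ ENNReal.ofReal t ^ q *
        (2 * μ {y ∈ ball x R | t / 3 < |w y - ⨍ z in ball x R, w z ∂μ|}) := by gcongr
    _ = 2 * ENNReal.ofReal (3 ^ q) * (ENNReal.ofReal (t / 3) ^ q *
        μ {y ∈ ball x R | t / 3 < |w y - ⨍ z in ball x R, w z ∂μ|}) := by rw [e]; ring
    _ ≤ 2 * ENNReal.ofReal (3 ^ q) * _ := mul_le_mul_right h1 _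
    _ = _ := by ring

end part3

section part4

lemma crossing {l : ℝ} (hl : 0 < l) {W : ℝ → ℝ} (hW : ContinuousOn W (Set.Icc 0 l))
    (hlt : W 0 < W l) : ∃ t0 t1, 0 ≤ t0 ∧ t0 < t1 ∧ t1 ≤ l ∧ W l - W 0 ≤ W t1 - W t0 ∧
      ∀ t ∈ Set.Ioo t0 t1, W 0 < W t ∧ W t < W l := by
  have hc1 : IsCompact (Set.Icc 0 l ∩ W ⁻¹' Set.Iic (W 0)) :=
    isCompact_Icc.of_isClosed_subset (hW.preimage_isClosed_of_isClosed isClosed_Icc isClosed_Iic)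
      Set.inter_subset_left
  obtain ⟨t0, ⟨ht0, ht0W⟩, hmax⟩ := hc1.exists_isGreatest
    ⟨0, ⟨Set.left_mem_Icc.2 hl.le, le_refl (W 0)⟩⟩
  have hc2 : IsCompact (Set.Icc t0 l ∩ W ⁻¹' Set.Ici (W l)) :=
    isCompact_Icc.of_isClosed_subset ((hW.mono (Set.Icc_subset_Icc_left ht0.1)
      ).preimage_isClosed_of_isClosed isClosed_Icc isClosed_Ici) Set.inter_subset_left
  obtain ⟨t1, ⟨ht1, ht1W⟩, hmin⟩ := hc2.exists_isLeast
    ⟨l, ⟨Set.right_mem_Icc.2 ht0.2, le_refl (W l)⟩⟩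
  simp only [Set.mem_preimage, Set.mem_Iic, Set.mem_Ici] at ht0W ht1W
  refine ⟨t0, t1, ht0.1, lt_of_le_of_ne ht1.1 ?_, ht1.2, by linarith, ?_⟩
  · rintro rfl; linarith
  · intro t ht
    constructor
    · by_contra! hcon
      have := hmax ⟨⟨ht0.1.trans ht.1.le, ht.2.le.trans ht1.2⟩, hcon⟩
      exact absurd ht.1 (by simpa using this)
    · by_contra! hcon
      have := hmin ⟨⟨ht.1.le, ht.2.le.trans ht1.2⟩, hcon⟩
      exact absurd ht.2 (by simpa using this)

lemma crossing' {l : ℝ} (hl : 0 < l) {W : ℝ → ℝ} (hW : ContinuousOn W (Set.Icc 0 l))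
    (hne : W 0 ≠ W l) : ∃ t0 t1, 0 ≤ t0 ∧ t0 < t1 ∧ t1 ≤ l ∧ |W 0 - W l| ≤ |W t0 - W t1| ∧
      ∀ t ∈ Set.Ioo t0 t1, min (W 0) (W l) < W t ∧ W t < max (W 0) (W l) := by
  rcases lt_or_gt_of_ne hne with h | h
  · obtain ⟨t0, t1, h0, h1, h2, h3, h4⟩ := crossing hl hW h
    refine ⟨t0, t1, h0, h1, h2, ?_, ?_⟩
    · rw [abs_sub_comm, abs_of_pos (sub_pos.2 h), abs_sub_comm]
      exact h3.trans (le_abs_self _)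
    · rw [min_eq_left h.le, max_eq_right h.le]; exact h4
  · obtain ⟨t0, t1, h0, h1, h2, h3, h4⟩ := crossing hl (W := fun t => - W t) hW.neg
      (by simpa using h)
    refine ⟨t0, t1, h0, h1, h2, ?_, ?_⟩
    · rw [abs_of_pos (sub_pos.2 h)]
      refine le_trans ?_ (le_abs_self _)
      linarith
    · rw [min_eq_right h.le, max_eq_left h.le]
      intro t ht
      have := h4 t ht
      constructor <;> linarith [this.1, this.2]

/-- truncation between the levels `a` and `b` -/
def trnc (a b v : ℝ) : ℝ := min (max (v - a) 0) (b - a)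

lemma trnc_lip {a b : ℝ} (v v' : ℝ) : |trnc a b v - trnc a b v'| ≤ |v - v'| := by
  unfold trnc
  refine (abs_min_sub_min_le_max _ _ _ _).trans ?_
  rw [sub_self, abs_zero, max_le_iff]
  refine ⟨(abs_max_sub_max_le_max _ _ _ _).trans ?_, abs_nonneg _⟩
  rw [sub_self, abs_zero, max_le_iff]
  exact ⟨by rw [sub_sub_sub_cancel_right], abs_nonneg _⟩

lemma trnc_nonneg {a b : ℝ} (hab : a < b) (v : ℝ) : 0 ≤ trnc a b v :=
  le_min (le_max_right _ _) (by linarith)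

lemma trnc_le {a b : ℝ} (v : ℝ) : trnc a b v ≤ b - a := min_le_right _ _

lemma trnc_mid {a b v : ℝ} (h0 : 0 < trnc a b v) (h1 : trnc a b v < b - a) : a < v ∧ v < b := by
  unfold trnc at *
  rw [lt_min_iff, lt_max_iff] at h0
  rw [min_lt_iff, max_lt_iff] at h1
  obtain ⟨h2 | h2, h3⟩ := h0
  · rcases h1 with h1 | h1
    · exact ⟨by linarith, by linarith [h1.1]⟩
    · linarith
  · linarith

lemma trnc_zero {a b v : ℝ} (hab : a < b) (h : v ≤ a) : trnc a b v = 0 := by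
  unfold trnc
  rw [max_eq_right (by linarith), min_eq_left (by linarith)]

lemma trnc_top {a b v : ℝ} (hab : a < b) (h : b ≤ v) : trnc a b v = b - a := by
  unfold trnc
  rw [max_eq_left (by linarith), min_eq_right (by linarith)]

lemma IsUpperGradient.sub {X : Type*} [MetricSpace X] {u : X → ℝ} {g : X → ℝ≥0∞}
    (hg : IsUpperGradient u g) {l : ℝ} {γ : ℝ → X} (hγ : LipschitzOnWith 1 γ (Set.Icc 0 l))
    {s t : ℝ} (hs : 0 ≤ s) (hst : s < t) (ht : t ≤ l) :
    ENNReal.ofReal |u (γ s) - u (γ t)| ≤ ∫⁻ τ in Set.Icc s t, g (γ τ) := by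
  have h := hg (t - s) (fun τ => γ (τ + s)) (by linarith) (by
    intro x hx y hy
    have := hγ (x := x + s) ⟨by linarith [hx.1], by linarith [hx.2]⟩ (y := y + s)
      ⟨by linarith [hy.1], by linarith [hy.2]⟩
    simpa using this)
  simp only [zero_add, sub_add_cancel] at h
  refine h.trans (le_of_eq ?_)
  rw [← lintegral_indicator measurableSet_Icc, ← lintegral_indicator measurableSet_Icc,
    ← lintegral_add_right_eq_self ((Set.Icc s t).indicator fun τ => g (γ τ)) s]
  refine lintegral_congr fun τ => ?_
  by_cases hτ : τ ∈ Set.Icc 0 (t - s)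
  · rw [Set.indicator_of_mem hτ, Set.indicator_of_mem]
    exact ⟨by linarith [hτ.1], by linarith [hτ.2]⟩
  · rw [Set.indicator_of_notMem hτ, Set.indicator_of_notMem]
    exact fun h => hτ ⟨by linarith [h.1], by linarith [h.2]⟩

lemma IsUpperGradient.contOn {X : Type*} [MetricSpace X] {u : X → ℝ} {g : X → ℝ≥0∞}
    (hg : IsUpperGradient u g) {l : ℝ} {γ : ℝ → X} (hγ : LipschitzOnWith 1 γ (Set.Icc 0 l))
    (hfin : ∫⁻ τ in Set.Icc 0 l, g (γ τ) ≠ ⊤) : ContinuousOn (fun t => u (γ t)) (Set.Icc 0 l) := by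
  rw [Metric.continuousOn_iff]
  intro s hs ε hε
  obtain ⟨δ, hδ, h⟩ := exists_pos_setLIntegral_lt_of_measure_lt hfin
    (ENNReal.ofReal_pos.2 hε).ne'
  obtain ⟨δ', hδ'0, hδ'⟩ : ∃ δ' : ℝ, 0 < δ' ∧ ENNReal.ofReal δ' ≤ δ := by
    rcases eq_or_ne δ ⊤ with rfl | hd
    · exact ⟨1, one_pos, le_top⟩
    · exact ⟨δ.toReal, ENNReal.toReal_pos hδ.ne' hd, ENNReal.ofReal_toReal_le⟩
  have main : ∀ a b, 0 ≤ a → a < b → b ≤ l → b - a < δ' → |u (γ a) - u (γ b)| < ε := by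
    intro a b ha hab hb hd
    have h1 := hg.sub hγ ha hab hb
    have h2 := h (Set.Icc a b) (by
      refine lt_of_le_of_lt (Measure.restrict_apply_le _ _) ?_
      rw [Real.volume_Icc]
      exact lt_of_lt_of_le ((ENNReal.ofReal_lt_ofReal_iff hδ'0).2 hd) hδ')
    rw [Measure.restrict_restrict measurableSet_Icc,
      Set.inter_eq_left.2 (Set.Icc_subset_Icc ha hb)] at h2
    exact (ENNReal.ofReal_lt_ofReal_iff hε).1 (h1.trans_lt h2)
  refine ⟨δ', hδ'0, fun t ht htd => ?_⟩
  rw [Real.dist_eq] at htd ⊢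
  rcases lt_trichotomy s t with hst | rfl | hst
  · rw [abs_sub_comm]
    exact main s t hs.1 hst ht.2 ((le_abs_self _).trans_lt htd)
  · simpa using hε
  · refine main t s ht.1 hst hs.2 (lt_of_le_of_lt ?_ htd)
    rw [abs_sub_comm]; exact le_abs_self _

lemma ug_trnc {X : Type*} [MetricSpace X] {u : X → ℝ} {g : X → ℝ≥0∞}
    (hg : IsUpperGradient u g) (c : ℝ) {a b : ℝ} (hab : a < b) {ε : ℝ≥0∞} (hε : ε ≠ 0)
    (hε' : ε ≠ ⊤) :
    IsUpperGradient (fun y => trnc a b |u y - c|)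
      (fun y => {y | a < |u y - c| ∧ |u y - c| < b}.indicator g y + ε * g y) := by
  intro l γ hl hγ
  by_cases hfin : ∫⁻ τ in Set.Icc 0 l, g (γ τ) = ⊤
  · refine le_trans le_top ?_
    calc (⊤ : ℝ≥0∞) = ε * ∫⁻ τ in Set.Icc 0 l, g (γ τ) := by
          rw [hfin, ENNReal.mul_top hε]
      _ = ∫⁻ τ in Set.Icc 0 l, ε * g (γ τ) := (lintegral_const_mul' _ _ hε').symm
      _ ≤ _ := lintegral_mono fun τ => le_add_self
  · set W : ℝ → ℝ := fun t => trnc a b |u (γ t) - c| with hW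
    have hlip : ∀ s t, |W s - W t| ≤ |u (γ s) - u (γ t)| := fun s t =>
      (trnc_lip _ _).trans ((abs_abs_sub_abs_le_abs_sub _ _).trans
        (by rw [sub_sub_sub_cancel_right]))
    have hWc : ContinuousOn W (Set.Icc 0 l) := by
      have h1 := hg.contOn hγ hfin
      have h2 : Continuous fun v : ℝ => trnc a b |v - c| := by unfold trnc; fun_prop
      exact h2.comp_continuousOn h1
    by_cases hne : W 0 = W l
    · have : ENNReal.ofReal |W 0 - W l| = 0 := by rw [hne]; simp
      change ENNReal.ofReal |W 0 - W l| ≤ _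
      rw [this]; exact zero_le
    obtain ⟨t0, t1, h0, h1, h2, h3, h4⟩ := crossing' hl hWc hne
    change ENNReal.ofReal |W 0 - W l| ≤ _
    calc ENNReal.ofReal |W 0 - W l| ≤ ENNReal.ofReal |u (γ t0) - u (γ t1)| :=
          ENNReal.ofReal_le_ofReal (h3.trans (hlip _ _))
      _ ≤ ∫⁻ τ in Set.Icc t0 t1, g (γ τ) := hg.sub hγ h0 h1 h2
      _ = ∫⁻ τ in Set.Ioo t0 t1, g (γ τ) := setLIntegral_congr Ioo_ae_eq_Icc.symm
      _ ≤ ∫⁻ τ in Set.Ioo t0 t1,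
          ({y | a < |u y - c| ∧ |u y - c| < b}.indicator g (γ τ) + ε * g (γ τ)) := by
          refine setLIntegral_mono' measurableSet_Ioo fun τ hτ => ?_
          rw [Set.indicator_of_mem]
          · exact le_self_add
          · have := h4 τ hτ
            refine trnc_mid (lt_of_le_of_lt ?_ this.1) (lt_of_lt_of_le this.2 ?_)
            · exact le_min (trnc_nonneg hab _) (trnc_nonneg hab _)
            · exact max_le (trnc_le _) (trnc_le _)
      _ ≤ _ := lintegral_mono_set (show Set.Ioo t0 t1 ⊆ Set.Icc 0 l from
          fun τ hτ => ⟨h0.trans hτ.1.le, hτ.2.le.trans h2⟩)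

variable {X : Type*} [MetricSpace X] [MeasurableSpace X] [BorelSpace X] {μ : Measure X}
  {K : ℝ≥0∞} {Q : ℝ}

lemma trunc_pair (hS : Sett μ K Q) {C_P σ p : ℝ} (hp : 1 < p) (hCP : 0 < C_P) (hσ : 1 ≤ σ)
    (hPI : ∀ (x : X) (r : ℝ), 0 < r →
      ∀ (v : X → ℝ) (ρ : X → ℝ≥0∞), Integrable v μ → Measurable ρ → IsUpperGradient v ρ →
        ⨍⁻ y in ball x r, ENNReal.ofReal |v y - ⨍ z in ball x r, v z ∂μ| ∂μ ≤
          ENNReal.ofReal (C_P * Metric.diam (ball x r)) *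
            (⨍⁻ y in ball x (σ * r), ρ y ^ p ∂μ) ^ (1 / p))
    {u : X → ℝ} {g : X → ℝ≥0∞} (hu : Measurable u) (hgm : Measurable g)
    (hg : IsUpperGradient u g) (hgp : ∫⁻ x, g x ^ p ∂μ < ⊤) (c : ℝ) {a b : ℝ} (hab : a < b) :
    PIpair μ (2 * C_P) σ p (fun y => trnc a b |u y - c|)
      ({y | a < |u y - c| ∧ |u y - c| < b}.indicator (fun y => g y ^ p)) := by
  have : IsFiniteMeasure μ := ⟨hS.fin⟩
  have hp0 : 0 < p := by linarith
  set S : Set X := {y | a < |u y - c| ∧ |u y - c| < b} with hSdef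
  have hm1 : Measurable fun y => |u y - c| := (hu.sub_const c).abs
  have hSm : MeasurableSet S :=
    (measurableSet_lt measurable_const hm1).inter (measurableSet_lt hm1 measurable_const)
  have hwm : Measurable fun y => trnc a b |u y - c| := by
    unfold trnc
    exact ((hm1.sub_const a).max measurable_const).min measurable_const
  have hgpm : Measurable fun y => g y ^ p := hgm.pow_const p
  have hwint : Integrable (fun y => trnc a b |u y - c|) μ := by
    refine Integrable.of_bound hwm.aestronglyMeasurable (b - a) (Eventually.of_forall fun y => ?_)
    rw [Real.norm_eq_abs, abs_of_nonneg (trnc_nonneg hab _)]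
    exact trnc_le _
  refine ⟨hwint, hgpm.indicator hSm, ?_, ?_⟩
  · exact (lintegral_mono fun y => Set.indicator_le_self _ _ y).trans_lt hgp
  intro x r hr
  set F := ⨍⁻ y in ball x (σ * r), S.indicator (fun y => g y ^ p) y ∂μ with hF
  set G := ⨍⁻ y in ball x (σ * r), g y ^ p ∂μ with hG
  have hσr : 0 < σ * r := by positivity
  have hGf : G ≠ ⊤ := by
    rw [hG, setLAverage_eq]
    exact ENNReal.div_ne_top ((setLIntegral_le_lintegral _ _).trans_lt hgp).ne
      (hS.pos x _ hσr).ne'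
  have hdiam : Metric.diam (ball x r) ≤ 2 * r := Metric.diam_ball hr.le
  have key : ∀ n : ℕ,
      ⨍⁻ y in ball x r, ENNReal.ofReal |trnc a b |u y - c| -
        ⨍ z in ball x r, trnc a b |u z - c| ∂μ| ∂μ ≤
      ENNReal.ofReal (2 * C_P * r) *
        ((1 + ((n : ℝ≥0∞) + 1)⁻¹) ^ p * F + (((n : ℝ≥0∞) + 1)⁻¹) ^ p * G) ^ (1 / p) := by
    intro n
    set ε : ℝ≥0∞ := ((n : ℝ≥0∞) + 1)⁻¹ with hε
    have hε0 : ε ≠ 0 := by simp [hε]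
    have hεf : ε ≠ ⊤ := by simp [hε]
    have h1 := hPI x r hr _ _ hwint ((hgm.indicator hSm).add (hgm.const_mul ε))
      (ug_trnc hg c hab hε0 hεf)
    refine h1.trans ?_
    gcongr ENNReal.ofReal ?_ * ?_ ^ _
    · nlinarith
    · rw [hF, hG, setLAverage_eq', setLAverage_eq', setLAverage_eq', ← lintegral_const_mul _
        (hgpm.indicator hSm), ← lintegral_const_mul _ hgpm,
        ← lintegral_add_left ((hgpm.indicator hSm).const_mul _)]
      refine lintegral_mono fun y => ?_
      by_cases hy : y ∈ S
      · simp only [Set.indicator_of_mem hy, Pi.add_apply]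
        refine le_trans (le_of_eq ?_) le_self_add
        rw [← ENNReal.mul_rpow_of_nonneg _ _ hp0.le]
        congr 1; ring
      · simp only [Set.indicator_of_notMem hy, Pi.add_apply, zero_add, mul_zero]
        rw [← ENNReal.mul_rpow_of_nonneg _ _ hp0.le]
  refine ge_of_tendsto' (x := atTop) ?_ key
  have hε : Tendsto (fun n : ℕ => ((n : ℝ≥0∞) + 1)⁻¹) atTop (𝓝 0) := by
    have := ENNReal.tendsto_inv_nat_nhds_zero.comp (tendsto_add_atTop_nat 1)
    simpa [Function.comp_def] using this
  have hFf : F ≠ ⊤ := by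
    refine ne_top_of_le_ne_top hGf ?_
    rw [hF, hG, setLAverage_eq', setLAverage_eq']
    exact lintegral_mono fun y => Set.indicator_le_self _ _ y
  have ht1 : Tendsto (fun n : ℕ => (1 + ((n : ℝ≥0∞) + 1)⁻¹) ^ p * F) atTop (𝓝 F) := by
    have h := ((ENNReal.continuous_rpow_const (y := p)).tendsto _).comp (hε.const_add 1)
    have h' := ENNReal.Tendsto.mul_const h (b := F) (Or.inr hFf)
    simpa [Function.comp_def] using h'
  have ht2 : Tendsto (fun n : ℕ => (((n : ℝ≥0∞) + 1)⁻¹) ^ p * G) atTop (𝓝 0) := by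
    have h := ((ENNReal.continuous_rpow_const (y := p)).tendsto _).comp hε
    have h' := ENNReal.Tendsto.mul_const h (b := G) (Or.inr hGf)
    simpa [Function.comp_def, ENNReal.zero_rpow_of_pos hp0] using h'
  have ht3 := ht1.add ht2
  rw [add_zero] at ht3
  have ht4 := ((ENNReal.continuous_rpow_const (y := 1 / p)).tendsto _).comp ht3
  exact ENNReal.Tendsto.const_mul ht4 (Or.inr ENNReal.ofReal_ne_top)

end part4

section part5

lemma tsum_rpow_le' (A : ℕ → ℝ≥0∞) {θ : ℝ} (hθ : 1 ≤ θ) :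
    ∑' j, A j ^ θ ≤ (∑' j, A j) ^ θ := by
  have key : ∀ x : ℝ≥0∞, x ^ θ = x * x ^ (θ - 1) := by
    intro x
    conv_lhs => rw [← add_sub_cancel 1 θ]
    rw [ENNReal.rpow_add_of_nonneg _ _ zero_le_one (by linarith), ENNReal.rpow_one]
  rw [key (∑' j, A j), ← ENNReal.tsum_mul_right]
  refine ENNReal.tsum_le_tsum fun j => ?_
  rw [key]
  gcongr
  exact ENNReal.le_tsum j

lemma layer {v τ q : ℝ} (hτ : 0 < τ) (hq : 0 < q) :
    ENNReal.ofReal v ^ q ≤ ENNReal.ofReal (2 * τ) ^ q + ∑' j : ℕ,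
      ENNReal.ofReal 4 ^ q * ENNReal.ofReal (2 ^ j * τ) ^ q *
        (if 2 ^ (j + 1) * τ ≤ v then 1 else 0) := by
  by_cases h : v ≤ 2 * τ
  · refine le_trans ?_ le_self_add
    gcongr
  · push Not at h
    refine le_trans ?_ le_add_self
    have h1 : 1 ≤ v / (2 * τ) := by rw [one_le_div (by positivity)]; exact h.le
    obtain ⟨n, hn1, hn2⟩ := exists_nat_pow_near h1 (one_lt_two)
    rw [le_div_iff₀ (by positivity)] at hn1
    rw [div_lt_iff₀ (by positivity)] at hn2
    refine le_trans ?_ (ENNReal.le_tsum n)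
    rw [if_pos (by rw [pow_succ]; linarith), mul_one, ← ENNReal.mul_rpow_of_nonneg _ _ hq.le,
      ← ENNReal.ofReal_mul (by norm_num)]
    gcongr
    rw [pow_succ] at hn2
    linarith

variable {X : Type*} [MetricSpace X] [MeasurableSpace X] [BorelSpace X] {μ : Measure X}
  {K : ℝ≥0∞} {Q : ℝ}

lemma half_of_avg (hS : Sett μ K Q) {v : X → ℝ} (hv : Measurable v) (x : X) {R a : ℝ}
    (hR : 0 < R) (ha : 0 < a)
    (h : ⨍⁻ y in ball x R, ENNReal.ofReal (v y) ∂μ ≤ ENNReal.ofReal a) :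
    μ (ball x R) ≤ 2 * μ {y ∈ ball x R | v y ≤ 2 * a} := by
  have hpos := (hS.pos x R hR).ne'
  rw [setLAverage_eq, ENNReal.div_le_iff hpos (hS.ne_top _)] at h
  have h1 := mul_meas_ge_le_lintegral (μ := μ.restrict (ball x R)) (hv.ennreal_ofReal)
    (ENNReal.ofReal (2 * a))
  have h2 := h1.trans h
  rw [ENNReal.ofReal_mul zero_le_two, mul_comm (ENNReal.ofReal 2), mul_assoc] at h2
  have ha' : ENNReal.ofReal a ≠ 0 := by simpa using ha
  rw [ENNReal.mul_le_mul_iff_right ha' ENNReal.ofReal_ne_top] at h2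
  set E := {y | ENNReal.ofReal a * ENNReal.ofReal 2 ≤ ENNReal.ofReal (v y)} with hE
  have hEm : MeasurableSet E := measurableSet_le measurable_const hv.ennreal_ofReal
  rw [Measure.restrict_apply hEm] at h2
  have h3 : μ (ball x R) ≤ μ {y ∈ ball x R | v y ≤ 2 * a} + μ (E ∩ ball x R) := by
    refine (measure_mono ?_).trans (measure_union_le _ _)
    intro y hy
    by_cases hy2 : v y ≤ 2 * a
    · exact Or.inl ⟨hy, hy2⟩
    · right
      refine ⟨?_, hy⟩
      rw [hE, Set.mem_ofPred_eq, ← ENNReal.ofReal_mul ha.le]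
      exact ENNReal.ofReal_le_ofReal (by linarith)
  have e2 : ENNReal.ofReal 2 = 2 := by simp
  rw [e2] at h2
  have h4 : μ (ball x R) + μ (ball x R) ≤
      2 * μ {y ∈ ball x R | v y ≤ 2 * a} + μ (ball x R) := by
    calc μ (ball x R) + μ (ball x R) = 2 * μ (ball x R) := by ring
      _ ≤ 2 * (μ {y ∈ ball x R | v y ≤ 2 * a} + μ (E ∩ ball x R)) := by gcongr
      _ = 2 * μ {y ∈ ball x R | v y ≤ 2 * a} + 2 * μ (E ∩ ball x R) := by ring
      _ ≤ _ := by gcongr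
  exact (ENNReal.add_le_add_iff_right (hS.ne_top _)).1 h4

lemma sobpoin (hS : Sett μ K Q) {C_P σ p q : ℝ} (hp : 1 < p) (hCP : 0 < C_P) (hσ : 1 ≤ σ)
    (hpQ : p < Q) (hq : 0 < q) (hpq : 1 / q = 1 / p - 1 / Q)
    (hPI : ∀ (x : X) (r : ℝ), 0 < r →
      ∀ (v : X → ℝ) (ρ : X → ℝ≥0∞), Integrable v μ → Measurable ρ → IsUpperGradient v ρ →
        ⨍⁻ y in ball x r, ENNReal.ofReal |v y - ⨍ z in ball x r, v z ∂μ| ∂μ ≤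
          ENNReal.ofReal (C_P * Metric.diam (ball x r)) *
            (⨍⁻ y in ball x (σ * r), ρ y ^ p ∂μ) ^ (1 / p))
    {u : X → ℝ} {g : X → ℝ≥0∞} (hu : Measurable u) (hgm : Measurable g)
    (hg : IsUpperGradient u g) (hgp : ∫⁻ x, g x ^ p ∂μ < ⊤) :
    ∃ C6 : ℝ≥0∞, C6 ≠ ⊤ ∧ ∀ (x : X) (R a c : ℝ), 0 < R → 0 < a →
      ⨍⁻ y in ball x R, ENNReal.ofReal |u y - c| ∂μ ≤ ENNReal.ofReal a →
      ⨍⁻ y in ball x R, ENNReal.ofReal |u y - c| ^ q ∂μ ≤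
        C6 * (ENNReal.ofReal a ^ q +
          ENNReal.ofReal R ^ q * (⨍⁻ z in ball x (2 * σ * R), g z ^ p ∂μ) ^ (q / p)) := by
  have hp0 : 0 < p := by linarith
  have hθ : 1 ≤ q / p := by
    have hQ := hS.Qpos
    rw [one_le_div hp0]
    have : 1 / q ≤ 1 / p := by rw [hpq]; linarith [one_div_pos.2 hQ]
    exact (one_div_le_one_div hq hp0).1 this
  obtain ⟨C4, hC4, hw⟩ := weak_half hS (C := 2 * C_P) (by positivity) hσ hp0 hpQ hq hpq
  refine ⟨ENNReal.ofReal 4 ^ q + ENNReal.ofReal 4 ^ q * C4, ?_, ?_⟩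
  · have : ENNReal.ofReal 4 ^ q ≠ ⊤ := ENNReal.rpow_ne_top_of_nonneg hq.le ENNReal.ofReal_ne_top
    exact ENNReal.add_ne_top.2 ⟨this, ENNReal.mul_ne_top this hC4⟩
  intro x R a c hR ha hav
  set B := ball x R with hB
  set τ := 2 * a with hτ
  have hτ0 : 0 < τ := by positivity
  have hvm : Measurable fun y => |u y - c| := (hu.sub_const c).abs
  have hBpos : μ B ≠ 0 := (hS.pos x R hR).ne'
  have hhalf := half_of_avg hS hvm x hR ha hav
  set L : ℕ → Set X := fun j => {y | 2 ^ j * τ < |u y - c| ∧ |u y - c| < 2 ^ (j + 1) * τ} with hL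
  set A : ℕ → ℝ≥0∞ := fun j =>
    ⨍⁻ z in ball x (2 * σ * R), (L j).indicator (fun y => g y ^ p) z ∂μ with hA
  set G := ⨍⁻ z in ball x (2 * σ * R), g z ^ p ∂μ with hG
  have hLm : ∀ j, MeasurableSet (L j) := fun j =>
    (measurableSet_lt measurable_const hvm).inter (measurableSet_lt hvm measurable_const)
  have hgpm : Measurable fun y => g y ^ p := hgm.pow_const p
  have hpw : ∀ j : ℕ, (2 : ℝ) ^ j * τ < 2 ^ (j + 1) * τ := fun j => by
    rw [pow_succ]; have : (0 : ℝ) < 2 ^ j * τ := by positivity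
    linarith
  have hLd : ∀ y i j, y ∈ L i → y ∈ L j → i = j := by
    have aux : ∀ y i j, y ∈ L i → y ∈ L j → ¬ i < j := by
      intro y i j hi hj hij
      have h1 : (2 : ℝ) ^ (i + 1) * τ ≤ 2 ^ j * τ := by
        gcongr
        · norm_num
        · exact hij
      linarith [hi.2, hj.1]
    intro y i j hi hj
    rcases lt_trichotomy i j with h | h | h
    · exact absurd h (aux y i j hi hj)
    · exact h
    · exact absurd h (aux y j i hj hi)
  have hsumA : ∑' j, A j ≤ G := by
    simp only [hA, hG, setLAverage_eq']
    rw [← lintegral_tsum fun j => (hgpm.indicator (hLm j)).aemeasurable]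
    refine lintegral_mono fun y => ?_
    by_cases hy : ∃ i, y ∈ L i
    · obtain ⟨i, hi⟩ := hy
      rw [tsum_eq_single i]
      · exact Set.indicator_le_self _ _ y
      · intro j hj
        rw [Set.indicator_of_notMem]
        exact fun hy => hj (hLd y j i hy hi)
    · push Not at hy
      have : ∀ i, (L i).indicator (fun y => g y ^ p) y = 0 := fun i =>
        Set.indicator_of_notMem (hy i) _
      simp [this]
  have hlev : ∀ j : ℕ, ENNReal.ofReal (2 ^ j * τ) ^ q * μ {y ∈ B | 2 ^ (j + 1) * τ ≤ |u y - c|} ≤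
      C4 * ENNReal.ofReal R ^ q * A j ^ (q / p) * μ B := by
    intro j
    have hpair := trunc_pair hS hp hCP hσ hPI hu hgm hg hgp c (hpw j)
    have h1 := hw _ _ hpair (fun y => trnc_nonneg (hpw j) _) x R hR ?_ (2 ^ j * τ) (by positivity)
    · refine le_trans ?_ h1
      refine mul_le_mul' le_rfl (measure_mono ?_)
      rintro y ⟨hyB, hy⟩
      refine ⟨hyB, ?_⟩
      rw [trnc_top (hpw j) hy, pow_succ]
      linarith
    · refine hhalf.trans ?_
      refine mul_le_mul' le_rfl (measure_mono ?_)
      rintro y ⟨hyB, hy⟩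
      refine ⟨hyB, trnc_zero (hpw j) (hy.trans ?_)⟩
      exact le_mul_of_one_le_left hτ0.le (one_le_pow₀ one_le_two)
  have hmain : ∫⁻ y in B, ENNReal.ofReal |u y - c| ^ q ∂μ ≤
      (ENNReal.ofReal (2 * τ) ^ q + ENNReal.ofReal 4 ^ q *
        (C4 * ENNReal.ofReal R ^ q * G ^ (q / p))) * μ B := by
    have hEm : ∀ j : ℕ, MeasurableSet {y | 2 ^ (j + 1) * τ ≤ |u y - c|} := fun j =>
      measurableSet_le measurable_const hvm
    calc ∫⁻ y in B, ENNReal.ofReal |u y - c| ^ q ∂μ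
        ≤ ∫⁻ y in B, (ENNReal.ofReal (2 * τ) ^ q + ∑' j : ℕ,
            ENNReal.ofReal 4 ^ q * ENNReal.ofReal (2 ^ j * τ) ^ q *
              ({y | 2 ^ (j + 1) * τ ≤ |u y - c|}.indicator 1 y)) ∂μ := by
          refine lintegral_mono fun y => (layer hτ0 hq).trans (le_of_eq ?_)
          congr 1
      _ = ENNReal.ofReal (2 * τ) ^ q * μ B + ∑' j : ℕ,
            ENNReal.ofReal 4 ^ q * (ENNReal.ofReal (2 ^ j * τ) ^ q *
              μ {y ∈ B | 2 ^ (j + 1) * τ ≤ |u y - c|}) := by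
          rw [lintegral_add_left measurable_const, setLIntegral_const, lintegral_tsum fun j =>
            ((measurable_one.indicator (hEm j)).const_mul _).aemeasurable]
          congr 1
          refine tsum_congr fun j => ?_
          rw [lintegral_const_mul _ (measurable_one.indicator (hEm j)),
            lintegral_indicator_one (hEm j), Measure.restrict_apply (hEm j), mul_assoc,
            Set.inter_comm]
          rfl
      _ ≤ ENNReal.ofReal (2 * τ) ^ q * μ B + ∑' j : ℕ,
            ENNReal.ofReal 4 ^ q * (C4 * ENNReal.ofReal R ^ q * A j ^ (q / p) * μ B) := by
          exact add_le_add le_rfl (ENNReal.tsum_le_tsum fun j => mul_le_mul' le_rfl (hlev j))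
      _ = ENNReal.ofReal (2 * τ) ^ q * μ B + 
            ENNReal.ofReal 4 ^ q * (C4 * ENNReal.ofReal R ^ q * (∑' j, A j ^ (q / p)) * μ B) := by
          rw [ENNReal.tsum_mul_left, ENNReal.tsum_mul_right, ENNReal.tsum_mul_left]
      _ ≤ ENNReal.ofReal (2 * τ) ^ q * μ B + 
            ENNReal.ofReal 4 ^ q * (C4 * ENNReal.ofReal R ^ q * (G ^ (q / p)) * μ B) := by
          gcongr
          exact (tsum_rpow_le' A hθ).trans (by gcongr)
      _ = _ := by ring
  rw [setLAverage_eq, ENNReal.div_le_iff hBpos (hS.ne_top _)]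
  refine hmain.trans ?_
  gcongr
  have e1 : ENNReal.ofReal (2 * τ) ^ q = ENNReal.ofReal 4 ^ q * ENNReal.ofReal a ^ q := by
    rw [← ENNReal.mul_rpow_of_nonneg _ _ hq.le, ← ENNReal.ofReal_mul (by norm_num)]
    congr 2; rw [hτ]; ring
  rw [e1, add_mul, mul_add, mul_add]
  refine add_le_add le_self_add ?_
  refine le_trans (le_of_eq ?_) le_add_self
  ring

end part5

section part6

variable {X : Type*} [MetricSpace X] [MeasurableSpace X] [BorelSpace X] {μ : Measure X}
  {K : ℝ≥0∞} {Q : ℝ}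

lemma meas_ball_int (hS : Sett μ K Q) {f : X → ℝ≥0∞} (hf : Measurable f) (ρ : ℝ) :
    Measurable fun x => ∫⁻ y in ball x ρ, f y ∂μ := by
  have := hS.secondCountable
  have : IsFiniteMeasure μ := ⟨hS.fin⟩
  have hD : MeasurableSet {z : X × X | dist z.2 z.1 < ρ} :=
    (isOpen_lt (continuous_snd.dist continuous_fst) continuous_const).measurableSet
  have h := ((hf.comp measurable_snd).indicator hD).lintegral_prod_right' (ν := μ)
  convert h using 2 with x
  rw [← lintegral_indicator measurableSet_ball]
  rfl

lemma meas_ball_meas (hS : Sett μ K Q) (ρ : ℝ) : Measurable fun x => μ (ball x ρ) := by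
  have := meas_ball_int hS (f := fun _ => 1) measurable_const ρ
  simpa using this

lemma meas_ball_avg (hS : Sett μ K Q) {f : X → ℝ≥0∞} (hf : Measurable f) (ρ : ℝ) :
    Measurable fun x => ⨍⁻ y in ball x ρ, f y ∂μ := by
  simp only [setLAverage_eq]
  exact (meas_ball_int hS hf ρ).div (meas_ball_meas hS ρ)

lemma int_avg_le (hS : Sett μ K Q) {f : X → ℝ≥0∞} (hf : Measurable f) {ρ : ℝ} (hρ : 0 < ρ) :
    ∫⁻ x, ⨍⁻ y in ball x ρ, f y ∂μ ∂μ ≤ K * ∫⁻ y, f y ∂μ := by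
  have := hS.secondCountable
  have : IsFiniteMeasure μ := ⟨hS.fin⟩
  have hD : MeasurableSet {z : X × X | dist z.2 z.1 < ρ} :=
    (isOpen_lt (continuous_snd.dist continuous_fst) continuous_const).measurableSet
  have hm := meas_ball_meas hS ρ
  set F : X × X → ℝ≥0∞ := {z : X × X | dist z.2 z.1 < ρ}.indicator
    (fun z => (μ (ball z.1 ρ))⁻¹ * f z.2) with hF
  have hFm : Measurable F :=
    ((hm.comp measurable_fst).inv.mul (hf.comp measurable_snd)).indicator hD
  calc ∫⁻ x, ⨍⁻ y in ball x ρ, f y ∂μ ∂μ = ∫⁻ x, ∫⁻ y, F (x, y) ∂μ ∂μ := by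
        refine lintegral_congr fun x => ?_
        rw [setLAverage_eq, ENNReal.div_eq_inv_mul, ← lintegral_const_mul _ hf,
          ← lintegral_indicator measurableSet_ball]
        rfl
    _ = ∫⁻ y, ∫⁻ x, F (x, y) ∂μ ∂μ := lintegral_lintegral_swap hFm.aemeasurable
    _ ≤ ∫⁻ y, K * f y ∂μ := by
        refine lintegral_mono fun y => ?_
        calc ∫⁻ x, F (x, y) ∂μ ≤ ∫⁻ x in ball y ρ, K * (μ (ball y ρ))⁻¹ * f y ∂μ := by
              rw [← lintegral_indicator measurableSet_ball]
              refine lintegral_mono fun x => ?_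
              by_cases hx : dist y x < ρ
              · have hx' : x ∈ ball y ρ := by rwa [mem_ball, dist_comm]
                rw [Set.indicator_of_mem hx', hF, Set.indicator_of_mem
                  (show (x, y) ∈ {z : X × X | dist z.2 z.1 < ρ} from hx)]
                gcongr
                have := hS.vd y x ρ ρ hρ hx' hρ le_rfl
                rw [div_self hρ.ne', Real.one_rpow, ENNReal.ofReal_one, mul_one] at this
                rw [ENNReal.inv_le_iff_le_mul (fun _ => (hS.pos x ρ hρ).ne')
                  (fun h => absurd h (hS.ne_top _))]
                calc (1 : ℝ≥0∞) = μ (ball y ρ) * (μ (ball y ρ))⁻¹ :=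
                      (ENNReal.mul_inv_cancel (hS.pos y ρ hρ).ne' (hS.ne_top _)).symm
                  _ ≤ (K * μ (ball x ρ)) * (μ (ball y ρ))⁻¹ := by gcongr
                  _ = _ := by ring
              · rw [hF, Set.indicator_of_notMem
                  (show (x, y) ∉ {z : X × X | dist z.2 z.1 < ρ} from hx)]
                exact zero_le
          _ = K * f y * (μ (ball y ρ) * (μ (ball y ρ))⁻¹) := by rw [setLIntegral_const]; ring
          _ = K * f y := by
              rw [ENNReal.mul_inv_cancel (hS.pos y ρ hρ).ne' (hS.ne_top _), mul_one]
    _ = _ := lintegral_const_mul _ hf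

/-- Weighted dyadic sum of averages. -/
noncomputable def Ssum (μ : Measure X) (f : X → ℝ≥0∞) (p M : ℝ) (x : X) : ℝ≥0∞ :=
  ∑' j : ℕ, ENNReal.ofReal ((1 / 2) ^ j) ^ (p / 2) * ⨍⁻ y in ball x ((1 / 2) ^ j * M), f y ∂μ

lemma geo_sum_fin {s : ℝ} (hs : 0 < s) : ∑' j : ℕ, ENNReal.ofReal ((1 / 2) ^ j) ^ s ≠ ⊤ := by
  have e : ∀ j : ℕ, ENNReal.ofReal ((1 / 2) ^ j) ^ s = (ENNReal.ofReal ((1 / 2 : ℝ) ^ s)) ^ j := by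
    intro j
    rw [ENNReal.ofReal_rpow_of_pos (by positivity), ← ENNReal.ofReal_pow (by positivity),
      ← Real.rpow_natCast, ← Real.rpow_natCast, ← Real.rpow_mul (by norm_num),
      ← Real.rpow_mul (by norm_num), mul_comm]
  simp_rw [e]
  rw [ENNReal.tsum_geometric]
  refine ENNReal.inv_ne_top.2 (tsub_pos_of_lt ?_).ne'
  rw [ENNReal.ofReal_lt_one]
  exact Real.rpow_lt_one (by norm_num) (by norm_num) hs

lemma Ssum_meas (hS : Sett μ K Q) {f : X → ℝ≥0∞} (hf : Measurable f) (p M : ℝ) :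
    Measurable (Ssum μ f p M) := by
  unfold Ssum
  exact Measurable.tsum fun j => (meas_ball_avg hS hf _).const_mul _

lemma Ssum_int (hS : Sett μ K Q) {f : X → ℝ≥0∞} (hf : Measurable f) (hff : ∫⁻ y, f y ∂μ < ⊤)
    {p M : ℝ} (hp : 0 < p) (hM : 0 < M) : ∫⁻ x, Ssum μ f p M x ∂μ < ⊤ := by
  unfold Ssum
  rw [lintegral_tsum fun j => ((meas_ball_avg hS hf _).const_mul _).aemeasurable]
  calc _ ≤ ∑' j : ℕ, ENNReal.ofReal ((1 / 2) ^ j) ^ (p / 2) * (K * ∫⁻ y, f y ∂μ) := by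
        refine ENNReal.tsum_le_tsum fun j => ?_
        rw [lintegral_const_mul _ (meas_ball_avg hS hf _)]
        exact mul_le_mul' le_rfl (int_avg_le hS hf (by positivity))
    _ < ⊤ := by
        rw [ENNReal.tsum_mul_right]
        exact ENNReal.mul_lt_top (geo_sum_fin (by positivity)).lt_top
          (ENNReal.mul_lt_top hS.Kfin.lt_top hff)

lemma Ssum_bound (hS : Sett μ K Q) (f : X → ℝ≥0∞) {p M ρ : ℝ} (hp : 0 < p) (hM : 0 < M)
    (hρ : 0 < ρ) (hρM : ρ ≤ M) (x : X) :
    ENNReal.ofReal (ρ / M) ^ (p / 2) * ⨍⁻ y in ball x ρ, f y ∂μ ≤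
      K * ENNReal.ofReal (2 ^ Q) * Ssum μ f p M x := by
  obtain ⟨n, h1, h2⟩ := exists_nat_pow_near_of_lt_one (x := ρ / M) (y := (1 / 2 : ℝ))
    (by positivity) ((div_le_one hM).2 hρM) (by norm_num) (by norm_num)
  rw [lt_div_iff₀ hM] at h1
  have h2' := (div_le_iff₀ hM).1 h2
  have hR : 0 < (1 / 2 : ℝ) ^ n * M := by positivity
  have hv := hS.vd x x ((1 / 2) ^ n * M) ρ hR (mem_ball_self hR) hρ h2'
  have h3 : ((1 / 2) ^ n * M / ρ) ^ Q ≤ 2 ^ Q := by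
    refine Real.rpow_le_rpow (by positivity) ?_ hS.Qpos.le
    rw [div_le_iff₀ hρ]
    rw [pow_succ] at h1
    linarith
  have h4 := lavg_mono (ball_subset_ball h2') (c := K * ENNReal.ofReal (2 ^ Q))
    (ENNReal.mul_ne_top hS.Kfin ENNReal.ofReal_ne_top) (hS.ne_top _) (hS.pos x ρ hρ).ne'
    (hv.trans (by gcongr)) f
  calc _ ≤ ENNReal.ofReal ((1 / 2) ^ n) ^ (p / 2) * (K * ENNReal.ofReal (2 ^ Q) *
        ⨍⁻ y in ball x ((1 / 2) ^ n * M), f y ∂μ) := by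
        refine mul_le_mul' ?_ h4
        exact ENNReal.rpow_le_rpow (ENNReal.ofReal_le_ofReal h2) (by positivity)
    _ = K * ENNReal.ofReal (2 ^ Q) * (ENNReal.ofReal ((1 / 2) ^ n) ^ (p / 2) *
        ⨍⁻ y in ball x ((1 / 2) ^ n * M), f y ∂μ) := by ring
    _ ≤ _ := by
        refine mul_le_mul' le_rfl ?_
        exact ENNReal.le_tsum (f := fun j : ℕ => ENNReal.ofReal ((1 / 2) ^ j) ^ (p / 2) *
          ⨍⁻ y in ball x ((1 / 2) ^ j * M), f y ∂μ) n

lemma Ssum_key (hS : Sett μ K Q) (f : X → ℝ≥0∞) {p σ δ ρ : ℝ} (hp : 0 < p) (hσ : 1 ≤ σ)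
    (hδ : 0 < δ) (hρ : 0 < ρ) (hρδ : ρ ≤ 2 * δ) (x : X) :
    ENNReal.ofReal ρ * (⨍⁻ y in ball x (σ * ρ), f y ∂μ) ^ (1 / p) ≤
      (K * ENNReal.ofReal (2 ^ Q) * Ssum μ f p (σ * (2 * δ)) x) ^ (1 / p) *
        ENNReal.ofReal (2 * δ) ^ (1 / 2 : ℝ) * ENNReal.ofReal ρ ^ (1 / 2 : ℝ) := by
  have hσ0 : 0 < σ := by linarith
  have h := Ssum_bound hS f (p := p) (M := σ * (2 * δ)) (ρ := σ * ρ) hp (by positivity)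
    (by positivity) (by gcongr) x
  rw [mul_div_mul_left _ _ hσ0.ne'] at h
  have h2 := ENNReal.rpow_le_rpow h (z := 1 / p) (by positivity)
  rw [ENNReal.mul_rpow_of_nonneg _ _ (by positivity), ← ENNReal.rpow_mul] at h2
  rw [show p / 2 * (1 / p) = 1 / 2 by field_simp] at h2
  have hsq : ENNReal.ofReal ρ = ENNReal.ofReal ρ ^ (1 / 2 : ℝ) * ENNReal.ofReal ρ ^ (1 / 2 : ℝ) := by
    rw [← ENNReal.rpow_add_of_nonneg _ _ (by norm_num) (by norm_num)]
    norm_num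
  have hsp : ENNReal.ofReal ρ ^ (1 / 2 : ℝ) = ENNReal.ofReal (ρ / (2 * δ)) ^ (1 / 2 : ℝ) *
      ENNReal.ofReal (2 * δ) ^ (1 / 2 : ℝ) := by
    rw [← ENNReal.mul_rpow_of_nonneg _ _ (by norm_num), ← ENNReal.ofReal_mul (by positivity),
      div_mul_cancel₀ _ (by positivity)]
  calc _ = (ENNReal.ofReal (ρ / (2 * δ)) ^ (1 / 2 : ℝ) *
        (⨍⁻ y in ball x (σ * ρ), f y ∂μ) ^ (1 / p)) * ENNReal.ofReal (2 * δ) ^ (1 / 2 : ℝ) *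
        ENNReal.ofReal ρ ^ (1 / 2 : ℝ) := by
        conv_lhs => rw [hsq]
        nth_rewrite 1 [hsp]
        ring
    _ ≤ _ := by gcongr

end part6

section part7

lemma add_rpow_le_two {q : ℝ} (hq : 0 < q) (a b : ℝ≥0∞) :
    (a + b) ^ q ≤ 2 ^ q * (a ^ q + b ^ q) := by
  rcases le_total a b with h | h
  · calc (a + b) ^ q ≤ (2 * b) ^ q := by
          refine ENNReal.rpow_le_rpow ?_ hq.le
          rw [two_mul]; gcongr
      _ = 2 ^ q * b ^ q := ENNReal.mul_rpow_of_nonneg _ _ hq.le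
      _ ≤ _ := mul_le_mul' le_rfl le_add_self
  · calc (a + b) ^ q ≤ (2 * a) ^ q := by
          refine ENNReal.rpow_le_rpow ?_ hq.le
          rw [two_mul]; gcongr
      _ = 2 ^ q * a ^ q := ENNReal.mul_rpow_of_nonneg _ _ hq.le
      _ ≤ _ := mul_le_mul' le_rfl le_self_add

variable {X : Type*} [MetricSpace X] [MeasurableSpace X] [BorelSpace X] {μ : Measure X}
  {K : ℝ≥0∞} {Q : ℝ}

lemma osc_q (hS : Sett μ K Q) {C_P σ p q δ : ℝ} (hp : 1 < p) (hCP : 0 < C_P) (hσ : 1 ≤ σ)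
    (hpQ : p < Q) (hq : 0 < q) (hpq : 1 / q = 1 / p - 1 / Q) (hδ : 0 < δ)
    (hPI : ∀ (x : X) (r : ℝ), 0 < r →
      ∀ (v : X → ℝ) (ρ : X → ℝ≥0∞), Integrable v μ → Measurable ρ → IsUpperGradient v ρ →
        ⨍⁻ y in ball x r, ENNReal.ofReal |v y - ⨍ z in ball x r, v z ∂μ| ∂μ ≤
          ENNReal.ofReal (C_P * Metric.diam (ball x r)) *
            (⨍⁻ y in ball x (σ * r), ρ y ^ p ∂μ) ^ (1 / p))
    {u : X → ℝ} {g : X → ℝ≥0∞} (hu : Measurable u) (hui : Integrable u μ) (hgm : Measurable g)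
    (hg : IsUpperGradient u g) (hgp : ∫⁻ x, g x ^ p ∂μ < ⊤) :
    ∃ C8 : ℝ≥0∞, C8 ≠ ⊤ ∧ ∀ᵐ x ∂μ, ∀ r : ℝ, 0 < r → r < δ →
      ⨍⁻ y in ball x r, ENNReal.ofReal |u y - u x| ^ q ∂μ ≤
        C8 * ((K * ENNReal.ofReal (2 ^ Q) *
          (Ssum μ (fun y => g y ^ p) p (σ * (2 * δ)) x + 1)) ^ (1 / p) *
            ENNReal.ofReal r ^ (1 / 2 : ℝ)) ^ q := by
  have hp0 : 0 < p := by linarith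
  have hgpm : Measurable fun y => g y ^ p := hgm.pow_const p
  have hpair : PIpair μ (2 * C_P) σ p u (fun y => g y ^ p) := by
    refine ⟨hui, hgpm, hgp, fun x r hr => (hPI x r hr u g hui hgm hg).trans ?_⟩
    gcongr ENNReal.ofReal ?_ * _
    have hdiam : Metric.diam (ball x r) ≤ 2 * r := Metric.diam_ball hr.le
    nlinarith
  obtain ⟨C6, hC6, hsp⟩ := sobpoin hS hp hCP hσ hpQ hq hpq hPI hu hgm hg hgp
  set D : ℝ≥0∞ := K * ENNReal.ofReal (2 ^ Q) with hD
  have hDf : D ≠ ⊤ := ENNReal.mul_ne_top hS.Kfin ENNReal.ofReal_ne_top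
  have hD0 : D ≠ 0 := mul_ne_zero (lt_of_lt_of_le one_pos hS.Kone).ne'
    (by simp only [ne_eq, ENNReal.ofReal_eq_zero, not_le]; positivity)
  set H : ℝ≥0∞ := ENNReal.ofReal (2 * δ) ^ (1 / 2 : ℝ) with hH
  have hHf : H ≠ ⊤ := ENNReal.rpow_ne_top_of_nonneg (by norm_num) ENNReal.ofReal_ne_top
  have hH0 : H ≠ 0 := (ENNReal.rpow_pos (by simpa using hδ) ENNReal.ofReal_ne_top).ne'
  set Γ : ℝ≥0∞ := ∑' k : ℕ, ENNReal.ofReal ((1 / 2) ^ k) ^ (1 / 2 : ℝ) with hΓ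
  have hΓf : Γ ≠ ⊤ := geo_sum_fin (by norm_num)
  set P : ℝ≥0∞ := ENNReal.ofReal (2 * C_P) with hPdef
  have hPf : P ≠ ⊤ := ENNReal.ofReal_ne_top
  have hP0 : P ≠ 0 := by
    simp only [hPdef, ne_eq, ENNReal.ofReal_eq_zero, not_le]; positivity
  set c2 : ℝ≥0∞ := H * ENNReal.ofReal 2 ^ (1 / 2 : ℝ) with hc2
  have hc2f : c2 ≠ ⊤ :=
    ENNReal.mul_ne_top hHf (ENNReal.rpow_ne_top_of_nonneg (by norm_num) ENNReal.ofReal_ne_top)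
  set N : ℝ≥0∞ := D * P * (H * Γ) with hN
  have hNf : N ≠ ⊤ := ENNReal.mul_ne_top (ENNReal.mul_ne_top hDf hPf) (ENNReal.mul_ne_top hHf hΓf)
  refine ⟨2 ^ q * (C6 * ((P * H) ^ q + c2 ^ q) + N ^ q), ?_, ?_⟩
  · have aux : ∀ z : ℝ≥0∞, z ≠ ⊤ → z ^ q ≠ ⊤ := fun z hz => ENNReal.rpow_ne_top_of_nonneg hq.le hz
    exact ENNReal.mul_ne_top (aux _ (by norm_num)) (ENNReal.add_ne_top.2 ⟨ENNReal.mul_ne_top hC6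
      (ENNReal.add_ne_top.2 ⟨aux _ (ENNReal.mul_ne_top hPf hHf), aux _ hc2f⟩), aux _ hNf⟩)
  have hSint := Ssum_int hS hgpm hgp hp0 (M := σ * (2 * δ)) (by positivity)
  have hSm := Ssum_meas hS hgpm p (σ * (2 * δ))
  filter_upwards [ae_lt_top hSm hSint.ne, chain hS hpair (by positivity)] with x hxS hxc r hr hrδ
  set S := Ssum μ (fun y => g y ^ p) p (σ * (2 * δ)) x with hSdef
  set E := (D * (S + 1)) ^ (1 / p) with hE
  have hDS : D * (S + 1) ≠ ⊤ := ENNReal.mul_ne_top hDf (ENNReal.add_ne_top.2 ⟨hxS.ne, by norm_num⟩)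
  have hDS0 : D * (S + 1) ≠ 0 := mul_ne_zero hD0 (by simp)
  have hEf : E ≠ ⊤ := ENNReal.rpow_ne_top_of_nonneg (by positivity) hDS
  have hE0 : E ≠ 0 := (ENNReal.rpow_pos (pos_iff_ne_zero.2 hDS0) hDS).ne'
  have key : ∀ ρ : ℝ, 0 < ρ → ρ ≤ 2 * δ →
      ENNReal.ofReal ρ * (⨍⁻ y in ball x (σ * ρ), g y ^ p ∂μ) ^ (1 / p) ≤
        E * H * ENNReal.ofReal ρ ^ (1 / 2 : ℝ) := by
    intro ρ hρ hρδ
    refine (Ssum_key hS (fun y => g y ^ p) hp0 hσ hδ hρ hρδ x).trans ?_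
    refine mul_le_mul' (mul_le_mul' ?_ le_rfl) le_rfl
    refine ENNReal.rpow_le_rpow (mul_le_mul' le_rfl ?_) (by positivity)
    exact le_self_add
  set c := ⨍ z in ball x r, u z ∂μ with hc
  set Z := E * ENNReal.ofReal r ^ (1 / 2 : ℝ) with hZ
  have hrf : ENNReal.ofReal r ^ (1 / 2 : ℝ) ≠ ⊤ :=
    ENNReal.rpow_ne_top_of_nonneg (by norm_num) ENNReal.ofReal_ne_top
  have hr0 : ENNReal.ofReal r ^ (1 / 2 : ℝ) ≠ 0 :=
    (ENNReal.rpow_pos (by simpa using hr) ENNReal.ofReal_ne_top).ne'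
  have hZf : Z ≠ ⊤ := ENNReal.mul_ne_top hEf hrf
  have hZ0 : Z ≠ 0 := mul_ne_zero hE0 hr0
  have hPHZf : P * H * Z ≠ ⊤ := ENNReal.mul_ne_top (ENNReal.mul_ne_top hPf hHf) hZf
  have hPHZ0 : P * H * Z ≠ 0 := mul_ne_zero (mul_ne_zero hP0 hH0) hZ0
  -- first oscillation
  have h1 : ⨍⁻ y in ball x r, ENNReal.ofReal |u y - c| ∂μ ≤
      ENNReal.ofReal (P * H * Z).toReal := by
    rw [ENNReal.ofReal_toReal hPHZf]
    refine (hpair.pi x r hr).trans ?_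
    rw [ENNReal.ofReal_mul (by positivity), mul_assoc]
    calc _ ≤ P * (E * H * ENNReal.ofReal r ^ (1 / 2 : ℝ)) :=
          mul_le_mul' le_rfl (key r hr (by linarith))
      _ = _ := by rw [hZ]; ring
  have h2 := hsp x r _ c hr (ENNReal.toReal_pos hPHZ0 hPHZf) h1
  rw [ENNReal.ofReal_toReal hPHZf] at h2
  have h3 : ENNReal.ofReal r ^ q * (⨍⁻ z in ball x (2 * σ * r), g z ^ p ∂μ) ^ (q / p) ≤
      (c2 * Z) ^ q := by
    rw [show q / p = 1 / p * q by ring, ENNReal.rpow_mul, ← ENNReal.mul_rpow_of_nonneg _ _ hq.le]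
    refine ENNReal.rpow_le_rpow ?_ hq.le
    rw [show 2 * σ * r = σ * (2 * r) by ring]
    calc _ ≤ ENNReal.ofReal (2 * r) * (⨍⁻ z in ball x (σ * (2 * r)), g z ^ p ∂μ) ^ (1 / p) := by
          refine mul_le_mul' (ENNReal.ofReal_le_ofReal (by linarith)) le_rfl
      _ ≤ E * H * ENNReal.ofReal (2 * r) ^ (1 / 2 : ℝ) := key _ (by positivity) (by linarith)
      _ = _ := by
          rw [ENNReal.ofReal_mul (by norm_num), ENNReal.mul_rpow_of_nonneg _ _ (by norm_num),
            hc2, hZ]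
          ring
  have h4 : ENNReal.ofReal |c - u x| ≤ N * Z := by
    rw [abs_sub_comm]
    refine (hxc r hr).trans ?_
    calc _ ≤ D * P * ∑' k : ℕ, E * H * (ENNReal.ofReal ((1 / 2) ^ k) ^ (1 / 2 : ℝ) *
          ENNReal.ofReal r ^ (1 / 2 : ℝ)) := by
          refine mul_le_mul' le_rfl (ENNReal.tsum_le_tsum fun k => ?_)
          have hk : (1 / 2 : ℝ) ^ k ≤ 1 := pow_le_one₀ (by norm_num) (by norm_num)
          refine (key _ (by positivity) ?_).trans (le_of_eq ?_)
          · nlinarith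
          · rw [ENNReal.ofReal_mul (by positivity), ENNReal.mul_rpow_of_nonneg _ _ (by norm_num)]
      _ = _ := by
          rw [ENNReal.tsum_mul_left, ENNReal.tsum_mul_right, hN, hZ]
          ring
  have hBpos : μ (ball x r) ≠ 0 := (hS.pos x r hr).ne'
  have hconst : ⨍⁻ y in ball x r, ENNReal.ofReal |c - u x| ^ q ∂μ = ENNReal.ofReal |c - u x| ^ q := by
    rw [setLAverage_eq, setLIntegral_const, ENNReal.mul_div_cancel_right hBpos (hS.ne_top _)]
  calc ⨍⁻ y in ball x r, ENNReal.ofReal |u y - u x| ^ q ∂μ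
      ≤ 2 ^ q * (⨍⁻ y in ball x r, ENNReal.ofReal |u y - c| ^ q ∂μ +
        ENNReal.ofReal |c - u x| ^ q) := by
        rw [← hconst, setLAverage_eq', setLAverage_eq', setLAverage_eq',
          ← lintegral_add_right _ measurable_const,
          ← lintegral_const_mul' _ _ (ENNReal.rpow_ne_top_of_nonneg hq.le (by norm_num))]
        refine lintegral_mono fun y => ?_
        refine le_trans ?_ (add_rpow_le_two hq _ _)
        refine ENNReal.rpow_le_rpow ?_ hq.le
        rw [← ENNReal.ofReal_add (abs_nonneg _) (abs_nonneg _)]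
        exact ENNReal.ofReal_le_ofReal (abs_sub_le _ _ _)
    _ ≤ 2 ^ q * (C6 * ((P * H * Z) ^ q + (c2 * Z) ^ q) + (N * Z) ^ q) := by
        refine mul_le_mul' le_rfl (add_le_add (h2.trans ?_) (ENNReal.rpow_le_rpow h4 hq.le))
        gcongr
    _ = _ := by
        simp only [ENNReal.mul_rpow_of_nonneg _ Z hq.le]
        ring

end part7

section part8

lemma inner_fin {s δ : ℝ} (hs : 0 < s) (hδ : 0 < δ) :
    ∫⁻ r in Set.Ioo (0 : ℝ) δ, ENNReal.ofReal r ^ s / ENNReal.ofReal r ≠ ⊤ := by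
  have h : IntegrableOn (fun r : ℝ => r ^ (s - 1)) (Set.Ioo 0 δ) :=
    (intervalIntegral.integrableOn_Ioo_rpow_iff hδ).2 (by linarith)
  refine ne_of_lt (lt_of_le_of_lt (le_of_eq ?_) h.lintegral_lt_top)
  refine setLIntegral_congr_fun measurableSet_Ioo fun r hr => ?_
  have hr0 : 0 < r := hr.1
  rw [ENNReal.ofReal_rpow_of_pos hr0, ← ENNReal.ofReal_div_of_pos hr0, Real.rpow_sub_one hr0.ne']

variable {X : Type*} [MetricSpace X] [MeasurableSpace X] [BorelSpace X] {μ : Measure X}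
  {K : ℝ≥0∞} {Q : ℝ}

lemma jensen_avg (hS : Sett μ K Q) {v : X → ℝ} (hv : Measurable v) (x : X) {r h q : ℝ} (hr : 0 < r)
    (hh : 0 < h) (hhq : h ≤ q) :
    (⨍⁻ y in ball x r, ENNReal.ofReal |v y| ^ h ∂μ) ^ (1 / h) ≤
      (⨍⁻ y in ball x r, ENNReal.ofReal |v y| ^ q ∂μ) ^ (1 / q) := by
  have hB0 := (hS.pos x r hr).ne'
  have hprob : IsProbabilityMeasure ((μ (ball x r))⁻¹ • μ.restrict (ball x r)) := by
    constructor
    simp [ENNReal.inv_mul_cancel hB0 (hS.ne_top _)]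
  have := eLpNorm'_le_eLpNorm'_of_exponent_le (f := v) hh hhq
    ((μ (ball x r))⁻¹ • μ.restrict (ball x r)) hv.aestronglyMeasurable
  rw [setLAverage_eq', setLAverage_eq']
  simpa only [eLpNorm', ← ofReal_norm, Real.norm_eq_abs] using this

lemma final (hS : Sett μ K Q) {C_P σ p q h δ : ℝ} (hp : 1 < p) (hCP : 0 < C_P) (hσ : 1 ≤ σ)
    (hpQ : p < Q) (hq : 0 < q) (hpq : 1 / q = 1 / p - 1 / Q) (hδ : 0 < δ) (hh : 0 < h)
    (hhq : h ≤ q)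
    (hPI : ∀ (x : X) (r : ℝ), 0 < r →
      ∀ (v : X → ℝ) (ρ : X → ℝ≥0∞), Integrable v μ → Measurable ρ → IsUpperGradient v ρ →
        ⨍⁻ y in ball x r, ENNReal.ofReal |v y - ⨍ z in ball x r, v z ∂μ| ∂μ ≤
          ENNReal.ofReal (C_P * Metric.diam (ball x r)) *
            (⨍⁻ y in ball x (σ * r), ρ y ^ p ∂μ) ^ (1 / p))
    {u : X → ℝ} (hu : MemN1p μ p u) :
    ∫⁻ x, (∫⁻ r in Set.Ioo (0 : ℝ) δ,
        (⨍⁻ y in ball x r, ENNReal.ofReal |u y - u x| ^ h ∂μ) ^ (p / (h * (p - 1)))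
          / ENNReal.ofReal r) ^ (p - 1) ∂μ < ⊤ := by
  obtain ⟨hum, hup, g, hgm, hg, hgp⟩ := hu
  have hp0 : 0 < p := by linarith
  have hp1 : 0 < p - 1 := by linarith
  have : IsFiniteMeasure μ := ⟨hS.fin⟩
  have hui : Integrable u μ := by
    have h1 : MemLp u (ENNReal.ofReal p) μ := by
      refine ⟨hum.aestronglyMeasurable, ?_⟩
      rw [eLpNorm_lt_top_iff_lintegral_rpow_enorm_lt_top (by simpa using hp0)
        ENNReal.ofReal_ne_top, ENNReal.toReal_ofReal hp0.le]
      simpa only [← ofReal_norm, Real.norm_eq_abs] using hup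
    exact h1.integrable (by simpa using hp.le)
  obtain ⟨C8, hC8, hosc⟩ := osc_q hS hp hCP hσ hpQ hq hpq hδ hPI hum hui hgm hg hgp
  set D : ℝ≥0∞ := K * ENNReal.ofReal (2 ^ Q) with hD
  have hDf : D ≠ ⊤ := ENNReal.mul_ne_top hS.Kfin ENNReal.ofReal_ne_top
  set S := Ssum μ (fun y => g y ^ p) p (σ * (2 * δ)) with hSdef
  have hgpm : Measurable fun y => g y ^ p := hgm.pow_const p
  have hSint : ∫⁻ x, S x ∂μ < ⊤ := Ssum_int hS hgpm hgp hp0 (by positivity)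
  set I := ∫⁻ r in Set.Ioo (0 : ℝ) δ, ENNReal.ofReal r ^ (1 / 2 * (p / (p - 1))) / ENNReal.ofReal r
    with hI
  have hIf : I ≠ ⊤ := inner_fin (by positivity) hδ
  set c := (C8 ^ (1 / q)) ^ (p / (p - 1)) with hc
  have hcf : c ≠ ⊤ := ENNReal.rpow_ne_top_of_nonneg (by positivity)
    (ENNReal.rpow_ne_top_of_nonneg (by positivity) hC8)
  have hbound : ∀ᵐ x ∂μ, (∫⁻ r in Set.Ioo (0 : ℝ) δ,
        (⨍⁻ y in ball x r, ENNReal.ofReal |u y - u x| ^ h ∂μ) ^ (p / (h * (p - 1)))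
          / ENNReal.ofReal r) ^ (p - 1) ≤ c ^ (p - 1) * I ^ (p - 1) * D * (S x + 1) := by
    filter_upwards [hosc] with x hx
    have h1 : ∫⁻ r in Set.Ioo (0 : ℝ) δ,
        (⨍⁻ y in ball x r, ENNReal.ofReal |u y - u x| ^ h ∂μ) ^ (p / (h * (p - 1)))
          / ENNReal.ofReal r ≤ c * (D * (S x + 1)) ^ (1 / (p - 1)) * I := by
      rw [hI, ← lintegral_const_mul _ (by fun_prop)]
      refine setLIntegral_mono' measurableSet_Ioo fun r hr => ?_
      rw [← mul_div_assoc]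
      refine ENNReal.div_le_div_right ?_ _
      have hJ := jensen_avg hS (v := fun y => u y - u x) (hum.sub_const _) x hr.1 hh hhq
      have hx' := ENNReal.rpow_le_rpow (hx r hr.1 hr.2) (z := 1 / q) (by positivity)
      rw [ENNReal.mul_rpow_of_nonneg _ _ (by positivity : 0 ≤ 1 / q), ← ENNReal.rpow_mul _ q,
        mul_one_div_cancel hq.ne', ENNReal.rpow_one] at hx'
      have h2 := ENNReal.rpow_le_rpow (hJ.trans hx') (z := p / (p - 1)) (by positivity)
      rw [← ENNReal.rpow_mul, show 1 / h * (p / (p - 1)) = p / (h * (p - 1)) by field_simp] at h2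
      refine h2.trans (le_of_eq ?_)
      rw [ENNReal.mul_rpow_of_nonneg _ _ (by positivity), ENNReal.mul_rpow_of_nonneg _ _
        (by positivity), ← ENNReal.rpow_mul (ENNReal.ofReal r), ← ENNReal.rpow_mul (D * (S x + 1)),
        show 1 / p * (p / (p - 1)) = 1 / (p - 1) by field_simp, ← hc, ← mul_assoc c]
    refine (ENNReal.rpow_le_rpow h1 hp1.le).trans (le_of_eq ?_)
    rw [ENNReal.mul_rpow_of_nonneg _ _ hp1.le, ENNReal.mul_rpow_of_nonneg _ _ hp1.le,
      ← ENNReal.rpow_mul (D * (S x + 1)), one_div_mul_cancel hp1.ne', ENNReal.rpow_one]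
    ring
  refine (lintegral_mono_ae hbound).trans_lt ?_
  have hcst : c ^ (p - 1) * I ^ (p - 1) * D ≠ ⊤ :=
    ENNReal.mul_ne_top (ENNReal.mul_ne_top (ENNReal.rpow_ne_top_of_nonneg hp1.le hcf)
      (ENNReal.rpow_ne_top_of_nonneg hp1.le hIf)) hDf
  rw [lintegral_const_mul' _ _ hcst, lintegral_add_right _ measurable_const, lintegral_const,
    one_mul]
  exact ENNReal.mul_lt_top hcst.lt_top (ENNReal.add_lt_top.2 ⟨hSint, hS.fin⟩)

lemma mk_sett {Q Q' : ℝ} (hQ' : Q ≤ Q') (hQ : 0 < Q)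
    (hball : ∀ (x : X) (r : ℝ), 0 < r → 0 < μ (ball x r) ∧ μ (ball x r) < ⊤)
    (hfinX : μ Set.univ < ⊤) {C₀ : ℝ} (hC₀ : 0 < C₀)
    (hd : ∀ (x y : X) (R r : ℝ), 0 < R → y ∈ ball x R →
      0 < r → r ≤ R → ENNReal.ofReal (C₀ * (r / R) ^ Q) * μ (ball x R) ≤ μ (ball y r)) :
    Sett μ (max 1 (ENNReal.ofReal (1 / C₀))) Q' where
  fin := hfinX
  pos := fun x r hr => (hball x r hr).1
  Kfin := by simp
  Kone := le_max_left _ _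
  Qpos := by linarith
  vd := by
    intro x y R r hR hy hr hrR
    have h := hd x y R r hR hy hr hrR
    have h1 : 1 ≤ ENNReal.ofReal (1 / C₀ * (R / r) ^ Q') * ENNReal.ofReal (C₀ * (r / R) ^ Q) := by
      rw [← ENNReal.ofReal_mul (by positivity), ENNReal.one_le_ofReal]
      have h2 : (R / r) ^ Q ≤ (R / r) ^ Q' :=
        Real.rpow_le_rpow_of_exponent_le ((one_le_div hr).2 hrR) hQ'
      have h3 : (R / r) ^ Q * (r / R) ^ Q = 1 := by
        rw [← Real.mul_rpow (by positivity) (by positivity),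
          show R / r * (r / R) = 1 by field_simp, Real.one_rpow]
      calc (1 : ℝ) = (R / r) ^ Q * (r / R) ^ Q := h3.symm
        _ ≤ (R / r) ^ Q' * (r / R) ^ Q := by gcongr
        _ = _ := by field_simp
    calc μ (ball x R) ≤ ENNReal.ofReal (1 / C₀ * (R / r) ^ Q') *
          ENNReal.ofReal (C₀ * (r / R) ^ Q) * μ (ball x R) := le_mul_of_one_le_left' h1
      _ = ENNReal.ofReal (1 / C₀ * (R / r) ^ Q') *
          (ENNReal.ofReal (C₀ * (r / R) ^ Q) * μ (ball x R)) := mul_assoc _ _ _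
      _ ≤ ENNReal.ofReal (1 / C₀ * (R / r) ^ Q') * μ (ball y r) := mul_le_mul' le_rfl h
      _ ≤ _ := by
          rw [ENNReal.ofReal_mul (by positivity)]
          gcongr
          exact le_max_right _ _

end part8

/-- Let `(X, d, μ)` be complete, with a Borel regular doubling measure
positive and finite on balls, supporting a `p`-Poincaré inequality and having relative lower
volume decay of order `Q > 0`. Suppose either `1 < p < Q` and `0 < h ≤ Qp/(Q−p)`, or
`p = Q > 1` and `h > 0`. Let `0 < δ < ∞`, let `u ∈ N^{1,p}(X)` be pointwise defined everywhere
by its precise representative, and assume `μ(X) < ∞`. Then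
`∫_X ( ∫_0^δ ( ⨍_{B(x,r)} |u − u(x)|^h dμ )^{p/(h(p−1))} dr/r )^{p−1} dμ(x) < ∞`. -/
theorem stmt_14 {X : Type*} [MetricSpace X] [CompleteSpace X]
    [MeasurableSpace X] [BorelSpace X] (μ : Measure X)
    (hreg : ∀ s : Set X, ∃ B : Set X, MeasurableSet B ∧ s ⊆ B ∧ μ B = μ s)
    (hball : ∀ (x : X) (r : ℝ), 0 < r → 0 < μ (ball x r) ∧ μ (ball x r) < ⊤)
    (hdbl : ∃ Cμ : ℝ≥0∞, 1 ≤ Cμ ∧ ∀ (x : X) (r : ℝ), 0 < r →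
      μ (ball x (2 * r)) ≤ Cμ * μ (ball x r))
    (p h Q δ : ℝ) (hQpos : 0 < Q)
    (hQdecay : ∃ C₀ : ℝ, 0 < C₀ ∧ ∀ (x y : X) (R r : ℝ), 0 < R → y ∈ ball x R →
      0 < r → r ≤ R → ENNReal.ofReal (C₀ * (r / R) ^ Q) * μ (ball x R) ≤ μ (ball y r))
    (hcase : (1 < p ∧ p < Q ∧ 0 < h ∧ h ≤ Q * p / (Q - p)) ∨ (p = Q ∧ 1 < p ∧ 0 < h))
    (hδ : 0 < δ)
    (hPI : ∃ C_P : ℝ, 0 < C_P ∧ ∃ σ : ℝ, 1 ≤ σ ∧ ∀ (x : X) (r : ℝ), 0 < r →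
      ∀ (v : X → ℝ) (ρ : X → ℝ≥0∞), Integrable v μ → Measurable ρ → IsUpperGradient v ρ →
        ⨍⁻ y in ball x r, ENNReal.ofReal |v y - ⨍ z in ball x r, v z ∂μ| ∂μ ≤
          ENNReal.ofReal (C_P * Metric.diam (ball x r)) *
            (⨍⁻ y in ball x (σ * r), ρ y ^ p ∂μ) ^ (1 / p))
    (u : X → ℝ) (hu : MemN1p μ p u)
    (hprec : ∀ x : X, u x = limsup (fun r => ⨍ y in ball x r, u y ∂μ) (𝓝[>] (0 : ℝ)))
    (hfinX : μ Set.univ < ⊤) :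
    ∫⁻ x, (∫⁻ r in Set.Ioo (0 : ℝ) δ,
        (⨍⁻ y in ball x r, ENNReal.ofReal |u y - u x| ^ h ∂μ) ^ (p / (h * (p - 1)))
          / ENNReal.ofReal r) ^ (p - 1) ∂μ < ⊤ := by
  obtain ⟨C₀, hC₀, hd⟩ := hQdecay
  obtain ⟨C_P, hCP, σ, hσ, hPI⟩ := hPI
  obtain ⟨Q', hQQ', hp, hpQ', hh, hhq⟩ : ∃ Q', Q ≤ Q' ∧ 1 < p ∧ p < Q' ∧ 0 < h ∧
      h ≤ Q' * p / (Q' - p) := by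
    rcases hcase with ⟨hp, hpQ, hh, hhq⟩ | ⟨rfl, hp, hh⟩
    · exact ⟨Q, le_rfl, hp, hpQ, hh, hhq⟩
    · have hp0 : 0 < p := by linarith
      have he : 0 < p * p / h := by positivity
      refine ⟨p + p * p / h, by linarith, hp, by linarith, hh, ?_⟩
      rw [add_sub_cancel_left, le_div_iff₀ he, mul_div_cancel₀ _ hh.ne']
      nlinarith
  have hp0 : 0 < p := by linarith
  have hQ'0 : 0 < Q' := by linarith
  have hsub : 0 < Q' - p := by linarith
  refine final (mk_sett hQQ' hQpos hball hfinX hC₀ hd) hp hCP hσ hpQ'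
    (q := Q' * p / (Q' - p)) (by positivity) ?_ hδ hh hhq hPI hu
  field_simp
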